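/- arXiv:2004.01284 — 6 statements merged into one kernel-verified Lean document; each statement's English description precedes it below -/
import Mathlib

section
/- Let q ∈ (0,1), set r := 2/(1−q) (so r > 2), and define a_q(x) := r^{1−2/r}·(1 − r·cos²x) and u(x) := sin(x)^r / r for x ∈ [0,π]. Then u is twice continuously differentiable on [0,π], −u''(x) = a_q(x)·u(x)^q for all x ∈ [0,π], u(x) > 0 for all x ∈ (0,π), and u(0) = u(π) = u'(0) = u'(π) = u''(0) = u''(π) = 0. In particular, u is a nontrivial solution of both the Dirichlet problem (P_D) and the Neumann problem (P_N) on [0,π] with weight a_q and exponent q, and u is not strongly positive. -/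
open Real Set

/-- The explicit example: for `q ∈ (0,1)`, `r = 2/(1-q)`,
`a_q(x) = r^(1-2/r) (1 - r cos² x)` and `u(x) = sin(x)^r / r`, the function `u` is a
nontrivial `C²` solution of both the Dirichlet and Neumann problems on `[0, π]` which
is not strongly positive. -/
theorem stmt_0 (q : ℝ) (hq : q ∈ Set.Ioo (0 : ℝ) 1) :
    let r : ℝ := 2 / (1 - q)
    let a : ℝ → ℝ := fun x => r ^ (1 - 2 / r) * (1 - r * Real.cos x ^ 2)
    let u : ℝ → ℝ := fun x => Real.sin x ^ r / r
    2 < r ∧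
    ∃ u' u'' : ℝ → ℝ,
      (∀ x ∈ Set.Icc (0 : ℝ) π, HasDerivWithinAt u (u' x) (Set.Icc 0 π) x) ∧
      (∀ x ∈ Set.Icc (0 : ℝ) π, HasDerivWithinAt u' (u'' x) (Set.Icc 0 π) x) ∧
      ContinuousOn u'' (Set.Icc 0 π) ∧
      (∀ x ∈ Set.Icc (0 : ℝ) π, -u'' x = a x * u x ^ q) ∧
      (∀ x ∈ Set.Ioo (0 : ℝ) π, 0 < u x) ∧
      u 0 = 0 ∧ u π = 0 ∧ u' 0 = 0 ∧ u' π = 0 ∧ u'' 0 = 0 ∧ u'' π = 0 ∧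
      (∃ x ∈ Set.Icc (0 : ℝ) π, u x ≠ 0) := by
  intro r a u
  obtain ⟨hq0, hq1⟩ := hq
  have h1q : 0 < 1 - q := by linarith
  have hrq : r * (1 - q) = 2 := div_mul_cancel₀ 2 h1q.ne'
  have hr : 2 < r := by
    rw [lt_div_iff₀ h1q]
    linarith
  have hr0 : 0 < r := by linarith
  have hexp : 1 - 2 / r = q := by
    field_simp
    linarith
  have hupos : ∀ x ∈ Set.Ioo (0 : ℝ) π, 0 < u x := fun x hx =>
    div_pos (rpow_pos_of_pos (sin_pos_of_mem_Ioo hx) r) hr0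
  have h1 : r - 1 ≠ 0 := by linarith
  have h2 : r - 2 ≠ 0 := by linarith
  refine ⟨hr, fun x => sin x ^ (r - 1) * cos x,
    fun x => (r - 1) * sin x ^ (r - 2) * cos x ^ 2 - sin x ^ (r - 1) * sin x,
    fun x _ => ?_, fun x _ => ?_, ?_, fun x hx => ?_, hupos, ?_, ?_, ?_, ?_, ?_, ?_,
    π / 2, ⟨by positivity, by linarith [pi_pos]⟩,
    (hupos _ ⟨by positivity, by linarith [pi_pos]⟩).ne'⟩
  · have h := (((hasDerivAt_sin x).rpow_const (p := r) (Or.inr (by linarith))).div_const r)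
    refine (h.congr_deriv ?_).hasDerivWithinAt
    field_simp
  · have h := ((hasDerivAt_sin x).rpow_const (p := r - 1) (Or.inr (by linarith))).mul
      (hasDerivAt_cos x)
    refine (h.congr_deriv ?_).hasDerivWithinAt
    rw [show r - 1 - 1 = r - 2 by ring]
    ring
  · have hs : ∀ p : ℝ, 0 ≤ p → Continuous fun x => sin x ^ p := fun p hp =>
      continuous_sin.rpow_const fun _ => Or.inr hp
    exact (((continuous_const.mul (hs (r - 2) (by linarith))).mul (continuous_cos.pow 2)).sub
      ((hs (r - 1) (by linarith)).mul continuous_sin)).continuousOn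
  · have hsin : 0 ≤ sin x := sin_nonneg_of_mem_Icc hx
    have hu : u x ^ q = sin x ^ (r - 2) / r ^ q := by
      change (sin x ^ r / r) ^ q = _
      rw [div_rpow (rpow_nonneg hsin r) hr0.le, ← rpow_mul hsin,
        show r * q = r - 2 by linarith]
    have hmul : sin x ^ (r - 1) = sin x ^ (r - 2) * sin x := by
      rw [← rpow_add_one' hsin (by linarith), show r - 2 + 1 = r - 1 by ring]
    have hrpow : r ^ q ≠ 0 := (rpow_pos_of_pos hr0 q).ne'
    change -((r - 1) * sin x ^ (r - 2) * cos x ^ 2 - sin x ^ (r - 1) * sin x) =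
      r ^ (1 - 2 / r) * (1 - r * cos x ^ 2) * u x ^ q
    rw [hu, hexp, hmul]
    field_simp
    linear_combination sin x ^ (r - 2) * sin_sq_add_cos_sq x
  all_goals simp [u, zero_rpow, hr0.ne', h1, h2]
end

section
/- Let a(x) := 2·(1 − 4·cos²x) for x ∈ [0,π] (the weight a_q of the explicit example with q = 1/2), and let φ(x) := x² − πx + 1 − cos(2x). Then φ is twice continuously differentiable on [0,π], −φ''(x) = a(x) for all x ∈ [0,π], φ(0) = φ(π) = 0, and φ(x) < 0 for every x ∈ (0,π). (Thus φ = S(a), the solution of the Poisson problem with zero Dirichlet data, is everywhere negative in (0,π), even though the sublinear Dirichlet problem with this weight and q = 1/2 has a positive solution.) -/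
open Real Set

/-- For the weight `a(x) = 2(1 - 4 cos² x)` (the example weight with `q = 1/2`), the
solution `φ(x) = x² - πx + 1 - cos(2x)` of the Poisson problem `-φ'' = a`, `φ(0) = φ(π) = 0`
is everywhere negative in `(0, π)`. -/
theorem stmt_1 :
    let a : ℝ → ℝ := fun x => 2 * (1 - 4 * Real.cos x ^ 2)
    let φ : ℝ → ℝ := fun x => x ^ 2 - π * x + 1 - Real.cos (2 * x)
    ∃ φ' φ'' : ℝ → ℝ,
      (∀ x : ℝ, HasDerivAt φ (φ' x) x) ∧
      (∀ x : ℝ, HasDerivAt φ' (φ'' x) x) ∧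
      Continuous φ'' ∧
      (∀ x ∈ Set.Icc (0 : ℝ) π, -φ'' x = a x) ∧
      φ 0 = 0 ∧ φ π = 0 ∧
      (∀ x ∈ Set.Ioo (0 : ℝ) π, φ x < 0) := by
  intro a φ
  refine ⟨fun x => 2 * x - π + 2 * Real.sin (2 * x), fun x => 2 + 4 * Real.cos (2 * x),
    fun x => ?_, fun x => ?_, by fun_prop, fun x _ => ?_, by simp [φ], ?_, fun x hx => ?_⟩
  · have h2 : HasDerivAt (fun x : ℝ => 2 * x) 2 x := by
      simpa using (hasDerivAt_id x).const_mul 2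
    have hπ : HasDerivAt (fun x : ℝ => π * x) π x := by
      simpa using (hasDerivAt_id x).const_mul π
    refine ((((hasDerivAt_pow 2 x).sub hπ).add_const 1).sub h2.cos).congr_deriv ?_
    norm_num
    ring
  · have h2 : HasDerivAt (fun x : ℝ => 2 * x) 2 x := by
      simpa using (hasDerivAt_id x).const_mul 2
    refine ((h2.sub_const π).add (h2.sin.const_mul 2)).congr_deriv ?_
    ring
  · simp only [a, Real.cos_two_mul]
    ring
  · simp only [φ, Real.cos_two_pi]
    ring
  · obtain ⟨h0, h1⟩ := hx
    have hq : Real.cos (π - 2 * x) ≤ 1 - 2 / π ^ 2 * (π - 2 * x) ^ 2 :=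
      Real.cos_le_one_sub_mul_cos_sq (abs_le.2 ⟨by linarith, by linarith⟩)
    rw [Real.cos_pi_sub] at hq
    have hπ : 8 < π ^ 2 := by nlinarith [Real.pi_gt_three]
    have hu : 0 < x * (π - x) := mul_pos h0 (by linarith)
    have hlt : 8 / π ^ 2 * (x * (π - x)) < x * (π - x) :=
      mul_lt_of_lt_one_left hu ((div_lt_one (by positivity)).2 hπ)
    have he : 1 - 2 / π ^ 2 * (π - 2 * x) ^ 2 = 8 / π ^ 2 * (x * (π - x)) - 1 := by
      field_simp
      ring
    simp only [φ]
    linarith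
end

section
/- (Uniqueness of positive solutions for the Dirichlet problem.) Let Ω ⊆ ℝ^N be a bounded open set, a : closure(Ω) → ℝ continuous, and q ∈ (0,1). Suppose u₁ and u₂ are continuous on closure(Ω), twice differentiable in Ω, satisfy −Δuᵢ(x) = a(x)·uᵢ(x)^q for all x ∈ Ω, uᵢ > 0 in Ω, and uᵢ = 0 on the frontier of Ω (i = 1,2). Then u₁ = u₂ on closure(Ω). -/
open Real Set

open Filter Topology

/-- Second derivative test: at a local maximum the second derivative is nonpositive. -/
theorem IsLocalMax.second_deriv_nonpos {f f' : ℝ → ℝ} {f'' x : ℝ} (h : IsLocalMax f x)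
    (hf : ∀ᶠ t in 𝓝 x, HasDerivAt f (f' t) t) (hf' : HasDerivAt f' f'' x) : f'' ≤ 0 := by
  by_contra! hpos
  have hderiv : deriv f =ᶠ[𝓝 x] f' := hf.mono fun t ht => ht.deriv
  have hdd : deriv (deriv f) x = f'' := by rw [hderiv.deriv_eq, hf'.deriv]
  have hmin : IsLocalMin f x :=
    isLocalMin_of_deriv_deriv_pos (by rwa [hdd]) h.deriv_eq_zero hf.self_of_nhds.continuousAt
  have hconst : f =ᶠ[𝓝 x] fun _ => f x := by
    filter_upwards [h, hmin] with t h₁ h₂ using le_antisymm h₁ h₂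
  have hzero : deriv f =ᶠ[𝓝 x] fun _ => 0 := by
    simpa using hconst.deriv
  have : deriv (deriv f) x = 0 := by rw [hzero.deriv_eq]; simp
  linarith

theorem HasLineDerivAt.hasDerivAt_line {E : Type*} [AddCommGroup E] [Module ℝ E] {f : E → ℝ}
    {f' : ℝ} {x v : E} {t : ℝ} (h : HasLineDerivAt ℝ f f' (x + t • v) v) :
    HasDerivAt (fun s => f (x + s • v)) f' t := by
  have h' : HasDerivAt (fun s : ℝ => f (x + t • v + s • v)) f' (t - t) := by
    rw [sub_self]; exact h
  have := h'.comp_sub_const t t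
  refine this.congr_of_eventuallyEq (Eventually.of_forall fun s => ?_)
  simp only [add_assoc, ← add_smul, add_sub_cancel]

/-- Weak maximum principle for `Δz + b · ∇z ≥ 0` on `{z > 0}`, with `b` continuous. -/
theorem nonpos_of_laplacian_add_drift_nonneg {N : ℕ} (hN : 1 ≤ N)
    {Ω : Set (EuclideanSpace ℝ (Fin N))} (hΩopen : IsOpen Ω) (hΩbdd : Bornology.IsBounded Ω)
    {z : EuclideanSpace ℝ (Fin N) → ℝ} {p s b : Fin N → EuclideanSpace ℝ (Fin N) → ℝ}
    (hz : ContinuousOn z (closure Ω)) (hbd : ∀ x ∈ frontier Ω, z x ≤ 0)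
    (hp : ∀ x ∈ Ω, ∀ i, HasLineDerivAt ℝ z (p i x) x (EuclideanSpace.single i 1))
    (hs : ∀ x ∈ Ω, ∀ i, HasLineDerivAt ℝ (p i) (s i x) x (EuclideanSpace.single i 1))
    (hb : ∀ i, ContinuousOn (b i) Ω)
    (hL : ∀ x ∈ Ω, 0 < z x → 0 ≤ ∑ i, s i x + ∑ i, b i x * p i x) :
    ∀ x ∈ closure Ω, z x ≤ 0 := by
  intro x₀ hx₀
  by_contra! hM
  have hcpt : IsCompact (closure Ω) := hΩbdd.isCompact_closure
  let k : Fin N := ⟨0, hN⟩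
  let K := closure Ω ∩ z ⁻¹' Ici (z x₀ / 2)
  have hKcpt : IsCompact K :=
    hcpt.of_isClosed_subset (hz.preimage_isClosed_of_isClosed isClosed_closure isClosed_Ici)
      inter_subset_left
  have hKΩ : K ⊆ Ω := by
    rintro x ⟨hx, hzx⟩
    by_contra hxΩ
    have := hbd x ⟨hx, by rwa [hΩopen.interior_eq]⟩
    simp only [mem_preimage, mem_Ici] at hzx
    linarith
  obtain ⟨C, hC⟩ := hKcpt.exists_bound_of_continuousOn ((hb k).mono hKΩ)
  have hx₀K : x₀ ∈ K := ⟨hx₀, by simp only [mem_preimage, mem_Ici]; linarith⟩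
  have hC0 : 0 ≤ C := (norm_nonneg _).trans (hC x₀ hx₀K)
  set l := C + 1 with hl
  let h : EuclideanSpace ℝ (Fin N) → ℝ := fun x => exp (l * x k)
  have hcont : Continuous h := by fun_prop
  have hpos : ∀ x, 0 < h x := fun x => exp_pos _
  obtain ⟨H, hH⟩ := hcpt.exists_bound_of_continuousOn hcont.continuousOn
  have hH0 : 0 < H := (norm_pos_iff.2 (hpos x₀).ne').trans_le (hH x₀ hx₀)
  set ε := z x₀ / (4 * H) with hε
  have hε0 : 0 < ε := by positivity
  have hεH : ε * H = z x₀ / 4 := by rw [hε]; field_simp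
  obtain ⟨y, hy, hmax⟩ := hcpt.exists_isMaxOn ⟨x₀, hx₀⟩
    (hz.add (hcont.const_mul ε : Continuous fun x => ε * h x).continuousOn)
  have hyz : z x₀ / 2 ≤ z y := by
    have h₁ : z x₀ + ε * h x₀ ≤ z y + ε * h y := hmax hx₀
    have h₂ : ε * h y ≤ ε * H := by
      gcongr; exact (le_abs_self _).trans (hH y hy)
    have h₃ := mul_pos hε0 (hpos x₀)
    linarith
  have hyK : y ∈ K := ⟨hy, hyz⟩
  have hyΩ := hKΩ hyK
  have hloc : IsLocalMax (fun x => z x + ε * h x) y :=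
    hmax.isLocalMax (mem_of_superset (hΩopen.mem_nhds hyΩ) subset_closure)
  let d : Fin N → ℝ := fun i => if i = k then l else 0
  have hline (i : Fin N) (c : ℝ) (t : ℝ) :
      HasDerivAt (fun t : ℝ => c * h (y + t • EuclideanSpace.single i (1 : ℝ)))
        (c * d i * h (y + t • EuclideanSpace.single i (1 : ℝ))) t := by
    have h₁ : HasDerivAt (fun t : ℝ => l * (y + t • EuclideanSpace.single i (1 : ℝ)) k) (d i) t := by
      have : HasDerivAt (fun t : ℝ => l * (y k + t * (if k = i then 1 else 0)))
          (l * (1 * (if k = i then 1 else 0))) t :=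
        (((hasDerivAt_id t).mul_const _).const_add _).const_mul _
      convert this using 1
      · ext t; simp
      · simp [d, eq_comm]
    exact (h₁.exp.const_mul c).congr_deriv (by simp only [h]; ring)
  have htend (i : Fin N) : Tendsto (fun t : ℝ => y + t • EuclideanSpace.single i (1 : ℝ))
      (𝓝 0) (𝓝 y) := by
    have : Continuous (fun t : ℝ => y + t • EuclideanSpace.single i (1 : ℝ)) := by fun_prop
    simpa using this.tendsto 0
  have hloc' (i : Fin N) : IsLocalMax (fun t : ℝ =>
      z (y + t • EuclideanSpace.single i (1 : ℝ)) +
        ε * h (y + t • EuclideanSpace.single i (1 : ℝ))) 0 := by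
    have := (htend i).eventually hloc
    simpa [IsLocalMax, IsMaxFilter] using this
  have hd (i : Fin N) : ∀ᶠ t : ℝ in 𝓝 0, HasDerivAt (fun t : ℝ =>
      z (y + t • EuclideanSpace.single i (1 : ℝ)) +
        ε * h (y + t • EuclideanSpace.single i (1 : ℝ)))
      (p i (y + t • EuclideanSpace.single i (1 : ℝ)) +
        ε * d i * h (y + t • EuclideanSpace.single i (1 : ℝ))) t := by
    filter_upwards [(htend i).eventually (hΩopen.mem_nhds hyΩ)] with t ht
    exact (hp _ ht i).hasDerivAt_line.add (hline i ε t)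
  have hfirst (i : Fin N) : p i y = -(ε * d i * h y) := by
    have := (hloc' i).hasDerivAt_eq_zero (hd i).self_of_nhds
    simp only [zero_smul, add_zero] at this
    linarith
  have hsecond (i : Fin N) : s i y ≤ -(ε * d i * d i * h y) := by
    have hd₂ : HasDerivAt (fun t : ℝ => p i (y + t • EuclideanSpace.single i (1 : ℝ)))
      (s i y) 0 := hs y hyΩ i
    have := (hloc' i).second_deriv_nonpos (hd i) (hd₂.add (hline i (ε * d i) 0))
    simp only [zero_smul, add_zero] at this
    linarith
  have hsum₁ : ∑ i, s i y ≤ -(ε * l * l * h y) := by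
    refine (Finset.sum_le_sum fun i _ => hsecond i).trans_eq ?_
    rw [Finset.sum_eq_single k] <;> simp +contextual [d]
  have hsum₂ : ∑ i, b i y * p i y = -(b k y * (ε * l * h y)) := by
    rw [Finset.sum_congr rfl fun i _ => by rw [hfirst i], Finset.sum_eq_single k] <;>
      simp +contextual [d]
  have hbk : -C ≤ b k y := neg_le_of_abs_le (hC y hyK)
  have hlast : 0 < ε * l * h y * (l + b k y) :=
    mul_pos (mul_pos (mul_pos hε0 (by linarith)) (hpos y)) (by linarith)
  have := hL y hyΩ (by linarith)
  nlinarith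

/-- Comparison for positive solutions of `-Δu = a u^q`, via the substitution `w = u^(1-q)`, for
which `-Δw = (1-q) a + (q/(1-q)) |∇w|²/w`. -/
theorem le_of_sublinear_dirichlet {N : ℕ} (hN : 1 ≤ N) {Ω : Set (EuclideanSpace ℝ (Fin N))}
    (hΩopen : IsOpen Ω) (hΩbdd : Bornology.IsBounded Ω)
    {q : ℝ} (hq : q ∈ Set.Ioo (0 : ℝ) 1) {a : EuclideanSpace ℝ (Fin N) → ℝ}
    {u₁ u₂ : EuclideanSpace ℝ (Fin N) → ℝ}
    {u₁' u₂' : EuclideanSpace ℝ (Fin N) → (EuclideanSpace ℝ (Fin N) →L[ℝ] ℝ)}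
    {u₁'' u₂'' : EuclideanSpace ℝ (Fin N) →
      (EuclideanSpace ℝ (Fin N) →L[ℝ] (EuclideanSpace ℝ (Fin N) →L[ℝ] ℝ))}
    (hu₁cont : ContinuousOn u₁ (closure Ω)) (hu₂cont : ContinuousOn u₂ (closure Ω))
    (hu₁' : ∀ x ∈ Ω, HasFDerivAt u₁ (u₁' x) x)
    (hu₁'' : ∀ x ∈ Ω, HasFDerivAt u₁' (u₁'' x) x)
    (hu₂' : ∀ x ∈ Ω, HasFDerivAt u₂ (u₂' x) x)
    (hu₂'' : ∀ x ∈ Ω, HasFDerivAt u₂' (u₂'' x) x)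
    (hu₁pos : ∀ x ∈ Ω, 0 < u₁ x) (hu₂pos : ∀ x ∈ Ω, 0 < u₂ x)
    (hu₁bd : ∀ x ∈ frontier Ω, u₁ x = 0) (hu₂bd : ∀ x ∈ frontier Ω, u₂ x = 0)
    (heq₁ : ∀ x ∈ Ω,
      -(∑ i, u₁'' x (EuclideanSpace.single i 1) (EuclideanSpace.single i 1))
        = a x * u₁ x ^ q)
    (heq₂ : ∀ x ∈ Ω,
      -(∑ i, u₂'' x (EuclideanSpace.single i 1) (EuclideanSpace.single i 1))
        = a x * u₂ x ^ q) :
    ∀ x ∈ closure Ω, u₁ x ≤ u₂ x := by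
  obtain ⟨hq0, hq1⟩ := hq
  have hr : 0 < 1 - q := by linarith
  let e : Fin N → EuclideanSpace ℝ (Fin N) := fun i => EuclideanSpace.single i 1
  let P (u : EuclideanSpace ℝ (Fin N) → ℝ)
    (u' : EuclideanSpace ℝ (Fin N) → (EuclideanSpace ℝ (Fin N) →L[ℝ] ℝ))
    (i : Fin N) (x : EuclideanSpace ℝ (Fin N)) : ℝ := (1 - q) * (u x ^ (-q) * u' x (e i))
  let S (u : EuclideanSpace ℝ (Fin N) → ℝ)
    (u' : EuclideanSpace ℝ (Fin N) → (EuclideanSpace ℝ (Fin N) →L[ℝ] ℝ))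
    (u'' : EuclideanSpace ℝ (Fin N) →
      (EuclideanSpace ℝ (Fin N) →L[ℝ] (EuclideanSpace ℝ (Fin N) →L[ℝ] ℝ)))
    (i : Fin N) (x : EuclideanSpace ℝ (Fin N)) : ℝ :=
      (1 - q) * (u x ^ (-q) * u'' x (e i) (e i)) - q / (1 - q) * (P u u' i x ^ 2 / u x ^ (1 - q))
  have key {u : EuclideanSpace ℝ (Fin N) → ℝ}
      {u' : EuclideanSpace ℝ (Fin N) → (EuclideanSpace ℝ (Fin N) →L[ℝ] ℝ)}
      {u'' : EuclideanSpace ℝ (Fin N) →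
        (EuclideanSpace ℝ (Fin N) →L[ℝ] (EuclideanSpace ℝ (Fin N) →L[ℝ] ℝ))}
      (hu' : ∀ x ∈ Ω, HasFDerivAt u (u' x) x) (hu'' : ∀ x ∈ Ω, HasFDerivAt u' (u'' x) x)
      (hpos : ∀ x ∈ Ω, 0 < u x)
      (heq : ∀ x ∈ Ω, -(∑ i, u'' x (e i) (e i)) = a x * u x ^ q) :
      (∀ x ∈ Ω, ∀ i, HasLineDerivAt ℝ (fun x => u x ^ (1 - q)) (P u u' i x) x (e i)) ∧
      (∀ x ∈ Ω, ∀ i, HasLineDerivAt ℝ (P u u' i) (S u u' u'' i x) x (e i)) ∧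
      (∀ i, ContinuousOn (P u u' i) Ω) ∧
      (∀ x ∈ Ω, ∑ i, S u u' u'' i x =
        -((1 - q) * a x) - ∑ i, q / (1 - q) * (P u u' i x ^ 2 / u x ^ (1 - q))) := by
    have hx0 (x) (i : Fin N) : u (x + (0 : ℝ) • e i) = u x := by simp
    refine ⟨fun x hx i => ?_, fun x hx i => ?_, fun i x hx => ?_, fun x hx => ?_⟩
    · have h₁ : HasDerivAt (fun t : ℝ => u (x + t • e i)) (u' x (e i)) 0 :=
        (hu' x hx).hasLineDerivAt (e i)
      have h₂ := h₁.rpow_const (p := 1 - q) (Or.inl (by rw [hx0]; exact (hpos x hx).ne'))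
      rw [hx0] at h₂
      refine HasDerivAt.congr_deriv h₂ ?_
      simp only [P, show 1 - q - 1 = -q by ring]
      ring
    · have h₁ : HasDerivAt (fun t : ℝ => u (x + t • e i)) (u' x (e i)) 0 :=
        (hu' x hx).hasLineDerivAt (e i)
      have h₂ := h₁.rpow_const (p := -q) (Or.inl (by rw [hx0]; exact (hpos x hx).ne'))
      rw [hx0] at h₂
      have h₃ : HasDerivAt (fun t : ℝ => u' (x + t • e i) (e i)) (u'' x (e i) (e i)) 0 :=
        (((hu'' x hx).clm_apply (hasFDerivAt_const (e i) x)).hasLineDerivAt (e i)).congr_deriv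
          (by simp)
      have h₄ := (h₂.mul h₃).const_mul (1 - q)
      refine HasDerivAt.congr_deriv h₄ ?_
      simp only [P, S, zero_smul, add_zero]
      have hu := hpos x hx
      rw [show 1 - q = 1 + -q by ring, rpow_add hu, rpow_one, rpow_sub hu, rpow_one]
      have h₅ : 0 < u x ^ (-q) := rpow_pos_of_pos hu _
      have : 1 + -q ≠ 0 := by linarith
      field_simp
      ring
    · have h₁ := (hu' x hx).continuousAt.rpow_const (p := -q) (Or.inl (hpos x hx).ne')
      have h₂ : ContinuousAt (fun x => u' x (e i)) x :=
        (hu'' x hx).continuousAt.clm_apply continuousAt_const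
      exact ((h₁.mul h₂).const_mul (1 - q)).continuousWithinAt
    · have hu := hpos x hx
      simp only [S, Finset.sum_sub_distrib, ← Finset.mul_sum]
      have h₁ : ∑ i, u'' x (e i) (e i) = -(a x * u x ^ q) := by linarith [heq x hx]
      have h₂ : u x ^ (-q) * u x ^ q = 1 := by rw [← rpow_add hu]; simp
      rw [h₁]
      linear_combination (-(1 - q) * a x) * h₂
  obtain ⟨hp₁, hs₁, hc₁, hS₁⟩ := key hu₁' hu₁'' hu₁pos heq₁
  obtain ⟨hp₂, hs₂, hc₂, hS₂⟩ := key hu₂' hu₂'' hu₂pos heq₂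
  have hnonneg {u : EuclideanSpace ℝ (Fin N) → ℝ} (hpos : ∀ x ∈ Ω, 0 < u x)
      (hbd : ∀ x ∈ frontier Ω, u x = 0) : ∀ x ∈ closure Ω, 0 ≤ u x := by
    intro x hx
    by_cases hxΩ : x ∈ Ω
    · exact (hpos x hxΩ).le
    · exact (hbd x ⟨hx, by rwa [hΩopen.interior_eq]⟩).ge
  have hmain := nonpos_of_laplacian_add_drift_nonneg hN hΩopen hΩbdd
    (z := fun x => u₁ x ^ (1 - q) - u₂ x ^ (1 - q))
    (p := fun i x => P u₁ u₁' i x - P u₂ u₂' i x)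
    (s := fun i x => S u₁ u₁' u₁'' i x - S u₂ u₂' u₂'' i x)
    (b := fun i x => q / (1 - q) * ((P u₁ u₁' i x + P u₂ u₂' i x) / u₁ x ^ (1 - q)))
    ((hu₁cont.rpow_const fun _ _ => Or.inr hr.le).sub
      (hu₂cont.rpow_const fun _ _ => Or.inr hr.le))
    (fun x hx => by simp [hu₁bd x hx, hu₂bd x hx])
    (fun x hx i => HasDerivAt.sub (hp₁ x hx i) (hp₂ x hx i))
    (fun x hx i => HasDerivAt.sub (hs₁ x hx i) (hs₂ x hx i))
    (fun i => (((hc₁ i).add (hc₂ i)).div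
      ((hu₁cont.mono subset_closure).rpow_const fun _ _ => Or.inr hr.le)
      fun x hx => (rpow_pos_of_pos (hu₁pos x hx) _).ne').const_mul _)
    (fun x hx hz => by
      have hw₁ : 0 < u₁ x ^ (1 - q) := rpow_pos_of_pos (hu₁pos x hx) _
      have hw₂ : 0 < u₂ x ^ (1 - q) := rpow_pos_of_pos (hu₂pos x hx) _
      rw [Finset.sum_sub_distrib, hS₁ x hx, hS₂ x hx]
      have hinv : (u₁ x ^ (1 - q))⁻¹ ≤ (u₂ x ^ (1 - q))⁻¹ :=
        inv_anti₀ hw₂ (by linarith)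
      have : 0 ≤ ∑ i, q / (1 - q) *
          (P u₂ u₂' i x ^ 2 * ((u₂ x ^ (1 - q))⁻¹ - (u₁ x ^ (1 - q))⁻¹)) :=
        Finset.sum_nonneg fun i _ => mul_nonneg (by positivity)
          (mul_nonneg (sq_nonneg _) (by linarith))
      refine this.trans_eq ?_
      rw [show ∀ A B C D : ℝ, -A - B - (-A - C) + D = C - B + D by intros; ring,
        ← Finset.sum_sub_distrib, ← Finset.sum_add_distrib]
      refine Finset.sum_congr rfl fun i _ => ?_
      ring)
  intro x hx
  have h := hmain x hx
  exact (rpow_le_rpow_iff (hnonneg hu₁pos hu₁bd x hx) (hnonneg hu₂pos hu₂bd x hx) hr).1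
    (by linarith)

/-- Uniqueness of positive solutions for the Dirichlet problem: if `Ω ⊆ ℝ^N` is bounded
and open, `a` is continuous on `closure Ω`, `q ∈ (0,1)`, and `u₁, u₂` are continuous on
`closure Ω`, twice differentiable in `Ω`, positive in `Ω`, vanish on the frontier of `Ω`
and solve `-Δuᵢ = a(x) uᵢ^q` in `Ω`, then `u₁ = u₂` on `closure Ω`. -/
theorem stmt_3 {N : ℕ} (hN : 1 ≤ N) (Ω : Set (EuclideanSpace ℝ (Fin N)))
    (hΩopen : IsOpen Ω) (hΩbdd : Bornology.IsBounded Ω)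
    (q : ℝ) (hq : q ∈ Set.Ioo (0 : ℝ) 1)
    (a : EuclideanSpace ℝ (Fin N) → ℝ) (ha : ContinuousOn a (closure Ω))
    (u₁ u₂ : EuclideanSpace ℝ (Fin N) → ℝ)
    (u₁' u₂' : EuclideanSpace ℝ (Fin N) → (EuclideanSpace ℝ (Fin N) →L[ℝ] ℝ))
    (u₁'' u₂'' : EuclideanSpace ℝ (Fin N) →
      (EuclideanSpace ℝ (Fin N) →L[ℝ] (EuclideanSpace ℝ (Fin N) →L[ℝ] ℝ)))
    (hu₁cont : ContinuousOn u₁ (closure Ω)) (hu₂cont : ContinuousOn u₂ (closure Ω))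
    (hu₁' : ∀ x ∈ Ω, HasFDerivAt u₁ (u₁' x) x)
    (hu₁'' : ∀ x ∈ Ω, HasFDerivAt u₁' (u₁'' x) x)
    (hu₂' : ∀ x ∈ Ω, HasFDerivAt u₂ (u₂' x) x)
    (hu₂'' : ∀ x ∈ Ω, HasFDerivAt u₂' (u₂'' x) x)
    (hu₁pos : ∀ x ∈ Ω, 0 < u₁ x) (hu₂pos : ∀ x ∈ Ω, 0 < u₂ x)
    (hu₁bd : ∀ x ∈ frontier Ω, u₁ x = 0) (hu₂bd : ∀ x ∈ frontier Ω, u₂ x = 0)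
    (heq₁ : ∀ x ∈ Ω,
      -(∑ i, u₁'' x (EuclideanSpace.single i 1) (EuclideanSpace.single i 1))
        = a x * u₁ x ^ q)
    (heq₂ : ∀ x ∈ Ω,
      -(∑ i, u₂'' x (EuclideanSpace.single i 1) (EuclideanSpace.single i 1))
        = a x * u₂ x ^ q) :
    Set.EqOn u₁ u₂ (closure Ω) := by
  exact fun x hx => le_antisymm
    (le_of_sublinear_dirichlet hN hΩopen hΩbdd hq hu₁cont hu₂cont hu₁' hu₁'' hu₂' hu₂''
      hu₁pos hu₂pos hu₁bd hu₂bd heq₁ heq₂ x hx)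
    (le_of_sublinear_dirichlet hN hΩopen hΩbdd hq hu₂cont hu₁cont hu₂' hu₂'' hu₁' hu₁''
      hu₂pos hu₁pos hu₂bd hu₁bd heq₂ heq₁ x hx)
end

section
/- (Existence of a nontrivial solution for the one-dimensional Dirichlet problem.) Let L > 0, q ∈ (0,1), and let a : [0,L] → ℝ be continuous and change sign. Then the Dirichlet problem (P_D) has at least one nontrivial solution, i.e. there exists a twice continuously differentiable u : [0,L] → ℝ, not identically zero, with u ≥ 0 on [0,L], u(0) = u(L) = 0, and −u''(x) = a(x)·u(x)^q for all x ∈ [0,L]. -/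
open Real Set

/-- `u` (with first and second derivatives `u'`, `u''`) is a solution of the
one-dimensional Dirichlet problem `(P_D)` on `[0, L]` with weight `a` and exponent `q`:
`u` is twice continuously differentiable on `[0, L]`, nonnegative, vanishes at the
endpoints, and satisfies `-u'' = a(x) u^q` on `[0, L]`. -/
def DirichletSolution (L q : ℝ) (a u u' u'' : ℝ → ℝ) : Prop :=
  (∀ x ∈ Set.Icc (0 : ℝ) L, HasDerivWithinAt u (u' x) (Set.Icc 0 L) x) ∧
  (∀ x ∈ Set.Icc (0 : ℝ) L, HasDerivWithinAt u' (u'' x) (Set.Icc 0 L) x) ∧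
  ContinuousOn u'' (Set.Icc 0 L) ∧
  (∀ x ∈ Set.Icc (0 : ℝ) L, 0 ≤ u x) ∧
  u 0 = 0 ∧ u L = 0 ∧
  (∀ x ∈ Set.Icc (0 : ℝ) L, -u'' x = a x * u x ^ q)

/-- The weight `a` changes sign on `[0, L]`: it attains both positive and negative
values. -/
def ChangesSign (L : ℝ) (a : ℝ → ℝ) : Prop :=
  (∃ x ∈ Set.Icc (0 : ℝ) L, 0 < a x) ∧ (∃ x ∈ Set.Icc (0 : ℝ) L, a x < 0)

open Filter Topology MeasureTheory

/-- `v` is twice differentiable on the line, with `-v'' = h`. -/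
def HasNegSecondDeriv (v h : ℝ → ℝ) : Prop :=
  ∃ v' : ℝ → ℝ, (∀ x, HasDerivAt v (v' x) x) ∧ ∀ x, HasDerivAt v' (-h x) x

lemma HasNegSecondDeriv.continuous {v h : ℝ → ℝ} (hv : HasNegSecondDeriv v h) :
    Continuous v := by
  obtain ⟨v', h1, -⟩ := hv
  exact continuous_iff_continuousAt.2 fun x => (h1 x).continuousAt

lemma HasNegSecondDeriv.sub {v w h g : ℝ → ℝ} (hv : HasNegSecondDeriv v h)
    (hw : HasNegSecondDeriv w g) :
    HasNegSecondDeriv (fun x => v x - w x) (fun x => h x - g x) := by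
  obtain ⟨v', h1, h2⟩ := hv
  obtain ⟨w', h3, h4⟩ := hw
  refine ⟨fun x => v' x - w' x, fun x => (h1 x).sub (h3 x), fun x => ?_⟩
  exact ((h2 x).sub (h4 x)).congr_deriv (by ring)

/-- The weak maximum principle for `-v'' + k v` with `k > 0`. -/
lemma HasNegSecondDeriv.nonneg {v h : ℝ → ℝ} (hv : HasNegSecondDeriv v h) {c d k : ℝ}
    (hk : 0 < k) (hvc : 0 ≤ v c) (hvd : 0 ≤ v d)
    (hh : ∀ x ∈ Icc c d, 0 ≤ h x + k * v x) : ∀ x ∈ Icc c d, 0 ≤ v x := by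
  by_contra! hcon
  obtain ⟨z, hz, hvz⟩ := hcon
  obtain ⟨y, hy, hmin⟩ := isCompact_Icc.exists_isMinOn ⟨z, hz⟩ hv.continuous.continuousOn
  have hvy : v y < 0 := lt_of_le_of_lt (hmin hz) hvz
  have hcy : c < y := lt_of_le_of_ne hy.1 (by rintro rfl; linarith)
  have hyd : y < d := lt_of_le_of_ne hy.2 (by rintro rfl; linarith)
  have hlmin : IsLocalMin v y := hmin.isLocalMin (Icc_mem_nhds hcy hyd)
  obtain ⟨v', h1, h2⟩ := hv
  have hd : deriv v = v' := funext fun x => (h1 x).deriv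
  have hdd : deriv (deriv v) y = -h y := by rw [hd]; exact (h2 y).deriv
  have hneg : deriv (deriv v) y < 0 := by
    rw [hdd]; nlinarith [hh y hy]
  have hlmax : IsLocalMax v y :=
    isLocalMax_of_deriv_deriv_neg hneg hlmin.deriv_eq_zero (h1 y).continuousAt
  have hconst : v =ᶠ[nhds y] fun _ => v y := by
    filter_upwards [hlmin, hlmax] with x hx1 hx2 using le_antisymm hx2 hx1
  have h0 : deriv (deriv v) y = 0 := by
    rw [hconst.deriv.deriv_eq]; simp
  linarith

/-- `v` solves `-v'' = h` with continuous `h` and Dirichlet conditions at `0` and `L`. -/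
def IsLinearSolution (L : ℝ) (v h : ℝ → ℝ) : Prop :=
  HasNegSecondDeriv v h ∧ Continuous h ∧ v 0 = 0 ∧ v L = 0

/-- The solution formula for `-v'' = h` with Dirichlet conditions at `0` and `L`. -/
noncomputable def dirichletFormula (L : ℝ) (h : ℝ → ℝ) (x : ℝ) : ℝ :=
  x / L * (L * (∫ y in (0 : ℝ)..L, h y) - ∫ y in (0 : ℝ)..L, y * h y)
    - (x * (∫ y in (0 : ℝ)..x, h y) - ∫ y in (0 : ℝ)..x, y * h y)

lemma IsLinearSolution.eq_dirichletFormula {L : ℝ} (hL : L ≠ 0) {v h : ℝ → ℝ}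
    (hv : IsLinearSolution L v h) (x : ℝ) : v x = dirichletFormula L h x := by
  obtain ⟨⟨v', h1, h2⟩, hc, h0, hvL⟩ := hv
  have key : ∀ t : ℝ, t * (∫ y in (0 : ℝ)..t, h y) - (∫ y in (0 : ℝ)..t, y * h y)
      = t * v' 0 - v t := by
    intro t
    have e1 : (∫ y in (0 : ℝ)..t, h y) = -v' t - -v' 0 :=
      intervalIntegral.integral_eq_sub_of_hasDerivAt (f := fun y => -v' y)
        (fun y _ => (h2 y).neg.congr_deriv (neg_neg _)) (hc.intervalIntegrable _ _)
    have e2 : (∫ y in (0 : ℝ)..t, y * h y) = (v t - t * v' t) - (v 0 - 0 * v' 0) :=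
      intervalIntegral.integral_eq_sub_of_hasDerivAt (f := fun y => v y - y * v' y)
        (fun y _ => ((h1 y).sub ((hasDerivAt_id y).mul (h2 y))).congr_deriv (by simp))
        ((continuous_id.mul hc).intervalIntegrable _ _)
    rw [e1, e2, h0]; ring
  rw [dirichletFormula, key, key, hvL]
  field_simp
  ring

lemma isLinearSolution_dirichletFormula {L : ℝ} (hL : L ≠ 0) {h : ℝ → ℝ} (hc : Continuous h) :
    IsLinearSolution L (dirichletFormula L h) h := by
  set A : ℝ := L * (∫ y in (0 : ℝ)..L, h y) - ∫ y in (0 : ℝ)..L, y * h y with hA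
  have d1 : ∀ x : ℝ, HasDerivAt (fun x => ∫ y in (0 : ℝ)..x, h y) (h x) x := fun x =>
    hc.integral_hasStrictDerivAt 0 x |>.hasDerivAt
  have d2 : ∀ x : ℝ, HasDerivAt (fun x => ∫ y in (0 : ℝ)..x, y * h y) (x * h x) x := fun x =>
    (continuous_id.mul hc).integral_hasStrictDerivAt 0 x |>.hasDerivAt
  refine ⟨⟨fun x => A / L - ∫ y in (0 : ℝ)..x, h y, fun x => ?_, fun x => ?_⟩, hc, ?_, ?_⟩
  · refine ((((hasDerivAt_id x).div_const L).mul_const A).sub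
      (((hasDerivAt_id x).mul (d1 x)).sub (d2 x))).congr_deriv ?_
    simp only [id_eq]
    ring
  · exact (d1 x).const_sub (A / L)
  · simp [dirichletFormula]
  · rw [dirichletFormula, div_self hL]; ring

/-- Solvability of `-v'' + k v = g` with Dirichlet conditions at `0` and `L`. -/
lemma exists_isLinearSolution_add_mul {L k : ℝ} (hL : 0 < L) (hk : 0 < k) {g : ℝ → ℝ}
    (hg : Continuous g) : ∃ v, IsLinearSolution L v (fun x => g x - k * v x) := by
  obtain ⟨s, hs, rfl⟩ : ∃ s : ℝ, 0 < s ∧ s ^ 2 = k := ⟨√k, sqrt_pos.2 hk, sq_sqrt hk.le⟩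
  have hsL : sinh (s * L) ≠ 0 := (sinh_pos_iff.2 (mul_pos hs hL)).ne'
  set C : ℝ → ℝ := fun x => ∫ y in (0 : ℝ)..x, cosh (s * y) * g y with hC
  set D : ℝ → ℝ := fun x => ∫ y in (0 : ℝ)..x, sinh (s * y) * g y with hD
  have dC : ∀ x, HasDerivAt C (cosh (s * x) * g x) x := fun x =>
    ((continuous_cosh.comp (continuous_const.mul continuous_id)).mul
      hg).integral_hasStrictDerivAt 0 x |>.hasDerivAt
  have dD : ∀ x, HasDerivAt D (sinh (s * x) * g x) x := fun x =>
    ((continuous_sinh.comp (continuous_const.mul continuous_id)).mul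
      hg).integral_hasStrictDerivAt 0 x |>.hasDerivAt
  have ds : ∀ x, HasDerivAt (fun x => sinh (s * x)) (cosh (s * x) * s) x := fun x => by
    simpa using ((hasDerivAt_id x).const_mul s).sinh
  have dc : ∀ x, HasDerivAt (fun x => cosh (s * x)) (sinh (s * x) * s) x := fun x => by
    simpa using ((hasDerivAt_id x).const_mul s).cosh
  set w : ℝ → ℝ := fun x => (sinh (s * x) * C x - cosh (s * x) * D x) / s with hw
  set A : ℝ := w L / sinh (s * L) with hA
  have hv : HasNegSecondDeriv (fun x => A * sinh (s * x) - w x)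
      (fun x => g x - s ^ 2 * (A * sinh (s * x) - w x)) := by
    refine ⟨fun x => A * (cosh (s * x) * s) - (cosh (s * x) * C x - sinh (s * x) * D x),
      fun x => ?_, fun x => ?_⟩
    · refine (((ds x).const_mul A).sub
        ((((ds x).mul (dC x)).sub ((dc x).mul (dD x))).div_const s)).congr_deriv ?_
      field_simp
      ring
    · refine ((((dc x).mul_const s).const_mul A).sub
        (((dc x).mul (dC x)).sub ((ds x).mul (dD x)))).congr_deriv ?_
      simp only [hw]
      field_simp
      linear_combination (-g x) * cosh_sq_sub_sinh_sq (s * x)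
  refine ⟨_, hv, hg.sub (continuous_const.mul hv.continuous), ?_, ?_⟩
  · simp [hw, hC, hD]
  · simp only [hA]; field_simp; ring

/-- Bounded pointwise convergence of the right-hand sides passes to the limit in
`-v'' = h`, and the limit is again a classical solution when the limiting right-hand side
depends continuously on `x` and the limit. -/
lemma exists_isLinearSolution_of_tendsto {L C : ℝ} (hL : 0 < L) {v h : ℕ → ℝ → ℝ}
    (hv : ∀ n, IsLinearSolution L (v n) (h n)) (hC : ∀ n, ∀ x ∈ Icc 0 L, |h n x| ≤ C)
    {w : ℝ → ℝ} (hw : ∀ x ∈ Icc 0 L, Tendsto (fun n => v n x) atTop (𝓝 (w x)))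
    {F : ℝ → ℝ → ℝ} (hF : Continuous (Function.uncurry F))
    (hFw : ∀ x ∈ Icc 0 L, Tendsto (fun n => h n x) atTop (𝓝 (F x (w x)))) :
    ∃ u H, IsLinearSolution L u H ∧ ∀ x ∈ Icc 0 L, u x = w x ∧ H x = F x (u x) := by
  set g : ℝ → ℝ := fun x => F x (w x) with hg
  have hsub : ∀ x ∈ Icc 0 L, uIoc 0 x ⊆ Icc 0 L := fun x hx y hy => by
    rw [uIoc_of_le hx.1] at hy
    exact ⟨hy.1.le, hy.2.trans hx.2⟩
  have hgC : ∀ x ∈ Icc 0 L, |g x| ≤ C := fun x hx =>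
    le_of_tendsto (hFw x hx).abs (Eventually.of_forall fun n => hC n x hx)
  have hgm : AEStronglyMeasurable g (volume.restrict (Icc 0 L)) :=
    aestronglyMeasurable_of_tendsto_ae atTop
      (fun n => (hv n).2.1.aestronglyMeasurable)
      ((ae_restrict_iff' measurableSet_Icc).2 (Eventually.of_forall hFw))
  have hgi : IntegrableOn g (Icc 0 L) :=
    ⟨hgm, .restrict_of_bounded (C := C) (by simp)
      ((ae_restrict_iff' measurableSet_Icc).2 (Eventually.of_forall hgC))⟩
  have hygi : IntegrableOn (fun y => y * g y) (Icc 0 L) :=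
    hgi.continuousOn_mul continuousOn_id isCompact_Icc
  have t1 : ∀ x ∈ Icc 0 L, Tendsto (fun n => ∫ y in (0 : ℝ)..x, h n y) atTop
      (𝓝 (∫ y in (0 : ℝ)..x, g y)) := fun x hx =>
    intervalIntegral.tendsto_integral_filter_of_dominated_convergence (fun _ => C)
      (Eventually.of_forall fun n => (hv n).2.1.aestronglyMeasurable)
      (Eventually.of_forall fun n => Eventually.of_forall fun y hy => hC n y (hsub x hx hy))
      (by simp) (Eventually.of_forall fun y hy => hFw y (hsub x hx hy))
  have t2 : ∀ x ∈ Icc 0 L, Tendsto (fun n => ∫ y in (0 : ℝ)..x, y * h n y) atTop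
      (𝓝 (∫ y in (0 : ℝ)..x, y * g y)) := fun x hx =>
    intervalIntegral.tendsto_integral_filter_of_dominated_convergence (fun _ => L * C)
      (Eventually.of_forall fun n => (continuous_id.mul (hv n).2.1).aestronglyMeasurable)
      (Eventually.of_forall fun n => Eventually.of_forall fun y hy => by
        have hy' := hsub x hx hy
        rw [norm_mul, Real.norm_eq_abs, Real.norm_eq_abs, abs_of_nonneg hy'.1]
        exact mul_le_mul hy'.2 (hC n y hy') (abs_nonneg _) hL.le)
      (by simp)
      (Eventually.of_forall fun y hy => (hFw y (hsub x hx hy)).const_mul y)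
  have hLm : L ∈ Icc 0 L := right_mem_Icc.2 hL.le
  have hwS : ∀ x ∈ Icc 0 L, w x = dirichletFormula L g x := by
    intro x hx
    refine tendsto_nhds_unique (hw x hx) ?_
    simp_rw [fun n => (hv n).eq_dirichletFormula hL.ne' x, dirichletFormula]
    exact ((((t1 L hLm).const_mul L).sub (t2 L hLm)).const_mul _).sub
      (((t1 x hx).const_mul x).sub (t2 x hx))
  have hwc : ContinuousOn w (Icc 0 L) := by
    have huI : uIcc 0 L = Icc 0 L := uIcc_of_le hL.le
    have c1 : ContinuousOn (fun x => ∫ y in (0 : ℝ)..x, g y) (Icc 0 L) :=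
      huI ▸ intervalIntegral.continuousOn_primitive_interval (huI.symm ▸ hgi)
    have c2 : ContinuousOn (fun x => ∫ y in (0 : ℝ)..x, y * g y) (Icc 0 L) :=
      huI ▸ intervalIntegral.continuousOn_primitive_interval (huI.symm ▸ hygi)
    refine ContinuousOn.congr ?_ hwS
    exact ((continuousOn_id.div_const L).mul continuousOn_const).sub
      ((continuousOn_id.mul c1).sub c2)
  set W : ℝ → ℝ := IccExtend hL.le ((Icc 0 L).domRestrict w) with hW
  have hWw : ∀ x ∈ Icc 0 L, W x = w x := fun x hx => by
    rw [hW, IccExtend_of_mem _ _ hx]; rfl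
  have hWc : Continuous W := hwc.domRestrict.Icc_extend'
  set H : ℝ → ℝ := fun x => F x (W x) with hH
  have hHc : Continuous H := hF.comp (continuous_id.prodMk hWc)
  have hSg : ∀ x ∈ Icc 0 L, dirichletFormula L H x = dirichletFormula L g x := by
    have hHg : ∀ x ∈ Icc 0 L, ∀ y ∈ uIcc 0 x, H y = g y := fun x hx y hy => by
      rw [uIcc_of_le hx.1] at hy
      simp only [hH, hg, hWw y ⟨hy.1, hy.2.trans hx.2⟩]
    have e1 : ∀ x ∈ Icc 0 L, (∫ y in (0 : ℝ)..x, H y) = ∫ y in (0 : ℝ)..x, g y :=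
      fun x hx => intervalIntegral.integral_congr (hHg x hx)
    have e2 : ∀ x ∈ Icc 0 L, (∫ y in (0 : ℝ)..x, y * H y) = ∫ y in (0 : ℝ)..x, y * g y :=
      fun x hx => intervalIntegral.integral_congr fun y hy => by
        simp only [hHg x hx y hy]
    intro x hx
    rw [dirichletFormula, dirichletFormula, e1 x hx, e2 x hx, e1 L hLm, e2 L hLm]
  refine ⟨_, H, isLinearSolution_dirichletFormula hL.ne' hHc, fun x hx => ?_⟩
  have : dirichletFormula L H x = w x := by rw [hSg x hx, hwS x hx]
  exact ⟨this, by rw [this, hH]; simp only [hWw x hx]⟩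

/-- `φ` lies below every Dirichlet supersolution of `-v'' + k v = f(x, φ) + k φ`. -/
def IsLowerBarrier (L : ℝ) (f : ℝ → ℝ → ℝ) (φ : ℝ → ℝ) : Prop :=
  ∀ k > 0, ∀ v h : ℝ → ℝ, HasNegSecondDeriv v h → v 0 = 0 → v L = 0 →
    (∀ x ∈ Icc 0 L, f x (φ x) + k * φ x ≤ h x + k * v x) → ∀ x ∈ Icc 0 L, φ x ≤ v x

/-- Monotone iteration, started from the supersolution `s`. -/
lemma exists_solution_between {L k B C : ℝ} (hL : 0 < L) (hk : 0 < k) {f : ℝ → ℝ → ℝ}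
    (hf : Continuous (Function.uncurry f))
    (hfC : ∀ x ∈ Icc 0 L, ∀ t ∈ Icc 0 B, |f x t| ≤ C)
    (hmono : ∀ x ∈ Icc 0 L, ∀ t r, 0 ≤ t → t ≤ r → f x t + k * t ≤ f x r + k * r)
    {φ s σ : ℝ → ℝ} (hφ : IsLowerBarrier L f φ) (hφ0 : ∀ x ∈ Icc 0 L, 0 ≤ φ x)
    (hs : HasNegSecondDeriv s σ) (hs0 : 0 ≤ s 0) (hsL : 0 ≤ s L)
    (hsf : ∀ x ∈ Icc 0 L, f x (s x) ≤ σ x) (hφs : ∀ x ∈ Icc 0 L, φ x ≤ s x)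
    (hsB : ∀ x ∈ Icc 0 L, s x ≤ B) :
    ∃ u H, IsLinearSolution L u H ∧
      ∀ x ∈ Icc 0 L, φ x ≤ u x ∧ u x ≤ s x ∧ H x = f x (u x) := by
  have hT : ∀ w : {w : ℝ → ℝ // Continuous w}, ∃ v : {w : ℝ → ℝ // Continuous w},
      IsLinearSolution L v.1 (fun x => f x (w.1 x) + k * w.1 x - k * v.1 x) := fun w => by
    obtain ⟨v, hv⟩ := exists_isLinearSolution_add_mul hL hk
      (g := fun x => f x (w.1 x) + k * w.1 x)
      ((hf.comp (continuous_id.prodMk w.2)).add (continuous_const.mul w.2))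
    exact ⟨⟨v, hv.1.continuous⟩, hv⟩
  choose T hT using hT
  set z : ℕ → {w : ℝ → ℝ // Continuous w} := fun n => T^[n] ⟨s, hs.continuous⟩ with hz
  have hz0 : (z 0).1 = s := rfl
  have hzS : ∀ n, z (n + 1) = T (z n) := fun n => Function.iterate_succ_apply' T n _
  have hsol : ∀ n, IsLinearSolution L (z (n + 1)).1
      (fun x => f x ((z n).1 x) + k * (z n).1 x - k * (z (n + 1)).1 x) := fun n => by
    rw [hzS]; exact hT _
  have hlow : ∀ n, ∀ x ∈ Icc 0 L, φ x ≤ (z n).1 x := by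
    intro n
    induction n with
    | zero => exact hφs
    | succ n ih =>
      refine hφ k hk _ _ (hsol n).1 (hsol n).2.2.1 (hsol n).2.2.2 fun x hx => ?_
      have := hmono x hx _ _ (hφ0 x hx) (ih x hx)
      linarith
  have hanti : ∀ n, ∀ x ∈ Icc 0 L, (z (n + 1)).1 x ≤ (z n).1 x := by
    intro n
    induction n with
    | zero =>
      have := (hs.sub (hsol 0).1).nonneg (c := 0) (d := L) hk
        (by rw [(hsol 0).2.2.1]; linarith) (by rw [(hsol 0).2.2.2]; linarith)
        (fun x hx => by rw [hz0]; linarith [hsf x hx])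
      exact fun x hx => sub_nonneg.1 (this x hx)
    | succ n ih =>
      have := ((hsol n).1.sub (hsol (n + 1)).1).nonneg (c := 0) (d := L) hk
        (by rw [(hsol n).2.2.1, (hsol (n + 1)).2.2.1]; simp)
        (by rw [(hsol n).2.2.2, (hsol (n + 1)).2.2.2]; simp)
        (fun x hx => by
          have := hmono x hx _ _ ((hφ0 x hx).trans (hlow (n + 1) x hx)) (ih x hx)
          linarith)
      exact fun x hx => sub_nonneg.1 (this x hx)
  have hA : ∀ x ∈ Icc 0 L, Antitone fun n => (z n).1 x := fun x hx =>
    antitone_nat_of_succ_le fun n => hanti n x hx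
  have hle : ∀ n, ∀ x ∈ Icc 0 L, (z n).1 x ≤ s x := fun n x hx => hA x hx (Nat.zero_le n)
  have hlim : ∀ x ∈ Icc 0 L, Tendsto (fun n => (z n).1 x) atTop (𝓝 (⨅ n, (z n).1 x)) :=
    fun x hx => tendsto_atTop_ciInf (hA x hx)
      ⟨φ x, by rintro _ ⟨n, rfl⟩; exact hlow n x hx⟩
  have hlim' : ∀ x ∈ Icc 0 L,
      Tendsto (fun n => (z (n + 1)).1 x) atTop (𝓝 (⨅ n, (z n).1 x)) :=
    fun x hx => (hlim x hx).comp (tendsto_add_atTop_nat 1)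
  obtain ⟨u, H, hu, huw⟩ := exists_isLinearSolution_of_tendsto (C := C + k * B) hL hsol
    (fun n x hx => by
      have b1 := hfC x hx _ ⟨(hφ0 x hx).trans (hlow n x hx), (hle n x hx).trans (hsB x hx)⟩
      have b2 : |k * (z n).1 x - k * (z (n + 1)).1 x| ≤ k * B := by
        rw [← mul_sub, abs_mul, abs_of_pos hk]
        refine mul_le_mul_of_nonneg_left ?_ hk.le
        rw [abs_of_nonneg (by linarith [hanti n x hx])]
        linarith [hφ0 x hx, hlow (n + 1) x hx, hle n x hx, hsB x hx]
      rw [add_sub_assoc]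
      exact (abs_add_le _ _).trans (add_le_add b1 b2))
    hlim' hf
    (fun x hx => by
      have c1 : Tendsto (fun n => f x ((z n).1 x)) atTop (𝓝 (f x (⨅ n, (z n).1 x))) :=
        ((hf.comp (continuous_const.prodMk continuous_id)).tendsto _).comp (hlim x hx)
      have := (c1.add ((hlim x hx).const_mul k)).sub ((hlim' x hx).const_mul k)
      rwa [add_sub_cancel_right] at this)
  refine ⟨u, H, hu, fun x hx => ?_⟩
  obtain ⟨h1, h2⟩ := huw x hx
  refine ⟨?_, ?_, h2⟩
  · rw [h1]; exact ge_of_tendsto (hlim x hx) (Eventually.of_forall fun n => hlow n x hx)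
  · rw [h1]; exact le_of_tendsto (hlim x hx) (Eventually.of_forall fun n => hle n x hx)

/-- A sine arch supported on `[c, d]`. -/
noncomputable def sineArch (c d ε : ℝ) : ℝ → ℝ :=
  (Icc c d).indicator fun x => ε * sin (π / (d - c) * (x - c))

lemma sineArch_nonneg {c d ε : ℝ} (hε : 0 ≤ ε) (x : ℝ) : 0 ≤ sineArch c d ε x := by
  refine indicator_nonneg (fun x hx => mul_nonneg hε ?_) x
  rcases eq_or_lt_of_le (hx.1.trans hx.2) with rfl | hcd
  · simp
  have hdc : 0 < d - c := sub_pos.2 hcd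
  refine sin_nonneg_of_nonneg_of_le_pi
    (mul_nonneg (div_pos pi_pos hdc).le (sub_nonneg.2 hx.1)) ?_
  calc π / (d - c) * (x - c) ≤ π / (d - c) * (d - c) :=
        mul_le_mul_of_nonneg_left (by linarith [hx.2]) (div_pos pi_pos hdc).le
    _ = π := div_mul_cancel₀ _ hdc.ne'

lemma sineArch_le {c d ε : ℝ} (hε : 0 ≤ ε) (x : ℝ) : sineArch c d ε x ≤ ε :=
  indicator_apply_le' (fun _ => mul_le_of_le_one_right hε (sin_le_one _)) fun _ => hε

lemma sineArch_midpoint {c d : ℝ} (hcd : c < d) (ε : ℝ) :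
    sineArch c d ε ((c + d) / 2) = ε := by
  have hdc : d - c ≠ 0 := (sub_pos.2 hcd).ne'
  rw [sineArch, indicator_of_mem (by constructor <;> linarith)]
  have : π / (d - c) * ((c + d) / 2 - c) = π / 2 := by field_simp; ring
  rw [this, sin_pi_div_two, mul_one]

lemma isLowerBarrier_sineArch {L c d ε : ℝ} {f : ℝ → ℝ → ℝ} (hc : 0 ≤ c) (hcd : c < d)
    (hd : d ≤ L) (hε : 0 ≤ ε) (hf0 : ∀ x ∈ Icc 0 L, f x 0 = 0)
    (hf : ∀ x ∈ Icc c d, ∀ t ∈ Icc 0 ε, (π / (d - c)) ^ 2 * t ≤ f x t) :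
    IsLowerBarrier L f (sineArch c d ε) := by
  intro k hk v h hv hv0 hvL hle
  set ω := π / (d - c) with hω
  have hsub : ∀ x ∈ Icc c d, x ∈ Icc 0 L := fun x hx => ⟨hc.trans hx.1, hx.2.trans hd⟩
  have hφ : ∀ x ∈ Icc c d, sineArch c d ε x = ε * sin (ω * (x - c)) := fun x hx =>
    indicator_of_mem hx _
  have hφ' : ∀ x, x ∉ Icc c d → sineArch c d ε x = 0 := fun x hx => indicator_of_notMem hx _
  have hfφ : ∀ x ∈ Icc c d, ω ^ 2 * sineArch c d ε x ≤ f x (sineArch c d ε x) :=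
    fun x hx => hf x hx _ ⟨sineArch_nonneg hε x, sineArch_le hε x⟩
  have hpos : ∀ x ∈ Icc 0 L, 0 ≤ v x := by
    refine hv.nonneg hk hv0.ge hvL.ge fun x hx => ?_
    refine le_trans (add_nonneg ?_ (mul_nonneg hk.le (sineArch_nonneg hε x))) (hle x hx)
    by_cases hxc : x ∈ Icc c d
    · exact (mul_nonneg (sq_nonneg ω) (sineArch_nonneg hε x)).trans (hfφ x hxc)
    · rw [hφ' x hxc, hf0 x hx]
  have hψ : HasNegSecondDeriv (fun x => ε * sin (ω * (x - c)))
      (fun x => ω ^ 2 * (ε * sin (ω * (x - c)))) := by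
    have dl : ∀ x, HasDerivAt (fun x => ω * (x - c)) ω x := fun x => by
      simpa using ((hasDerivAt_id x).sub_const c).const_mul ω
    refine ⟨fun x => ε * (cos (ω * (x - c)) * ω), fun x => (dl x).sin.const_mul ε, fun x => ?_⟩
    exact (((dl x).cos.mul_const ω).const_mul ε).congr_deriv (by ring)
  have hωd : ω * (d - c) = π := div_mul_cancel₀ _ (sub_pos.2 hcd).ne'
  have hdiff := (hv.sub hψ).nonneg (c := c) (d := d) hk
    (by simpa using hpos c (hsub c (left_mem_Icc.2 hcd.le)))
    (by simpa [hωd] using hpos d (hsub d (right_mem_Icc.2 hcd.le)))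
    (fun x hx => by
      have h1 := hle x (hsub x hx)
      have h2 := hfφ x hx
      rw [hφ x hx] at h1 h2
      linarith)
  intro x hx
  by_cases hxc : x ∈ Icc c d
  · rw [hφ x hxc]; exact sub_nonneg.1 (hdiff x hxc)
  · rw [hφ' x hxc]; exact hpos x hx

/-- The nonlinearity `A(x) t ^ q` with its negative part regularised near `t = 0`. -/
noncomputable def regNonlinearity (A : ℝ → ℝ) (q δ x t : ℝ) : ℝ :=
  max (A x) 0 * t ^ q - max (-A x) 0 * (t * max t δ ^ (q - 1))

section regNonlinearity

variable {A : ℝ → ℝ} {q δ : ℝ}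

lemma continuous_regNonlinearity (hA : Continuous A) (hq : 0 < q) (hδ : 0 < δ) :
    Continuous (Function.uncurry (regNonlinearity A q δ)) := by
  have hA' : Continuous fun p : ℝ × ℝ => A p.1 := hA.comp continuous_fst
  have h1 : Continuous fun p : ℝ × ℝ => p.2 ^ q :=
    (continuous_rpow_const hq.le).comp continuous_snd
  have h2 : Continuous fun p : ℝ × ℝ => max p.2 δ ^ (q - 1) :=
    (continuous_snd.max continuous_const).rpow_const fun p =>
      Or.inl (lt_max_of_lt_right hδ).ne'
  exact ((hA'.max continuous_const).mul h1).sub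
    ((hA'.neg.max continuous_const).mul (continuous_snd.mul h2))

lemma rpow_eq_mul_rpow_sub_one (hq : 0 < q) {t : ℝ} (ht : 0 ≤ t) : t ^ q = t * t ^ (q - 1) := by
  rcases eq_or_lt_of_le ht with rfl | ht
  · simp [zero_rpow hq.ne']
  · rw [rpow_sub_one ht.ne']; field_simp

lemma mul_max_rpow_le (hq : q ∈ Ioo (0 : ℝ) 1) {t : ℝ} (ht : 0 ≤ t) :
    t * max t δ ^ (q - 1) ≤ t ^ q := by
  rw [rpow_eq_mul_rpow_sub_one hq.1 ht]
  rcases eq_or_lt_of_le ht with rfl | ht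
  · simp
  · exact mul_le_mul_of_nonneg_left
      (rpow_le_rpow_of_nonpos ht (le_max_left _ _) (by linarith [hq.2])) ht.le

lemma mul_max_rpow_nonneg {t : ℝ} (ht : 0 ≤ t) : 0 ≤ t * max t δ ^ (q - 1) :=
  mul_nonneg ht (rpow_nonneg (ht.trans (le_max_left _ _)) _)

lemma regNonlinearity_le_of_le (hq : q < 1) {δ' : ℝ} (hδ' : 0 < δ') (hδ : δ' ≤ δ) (x : ℝ)
    {t : ℝ} (ht : 0 ≤ t) : regNonlinearity A q δ' x t ≤ regNonlinearity A q δ x t := by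
  refine sub_le_sub_left (mul_le_mul_of_nonneg_left (mul_le_mul_of_nonneg_left ?_ ht)
    (le_max_right _ _)) _
  exact rpow_le_rpow_of_nonpos (lt_max_of_lt_right hδ') (max_le_max_left _ hδ) (by linarith)

lemma abs_regNonlinearity_le (hq : q ∈ Ioo (0 : ℝ) 1) {M B x t : ℝ} (hM : |A x| ≤ M)
    (ht : t ∈ Icc 0 B) : |regNonlinearity A q δ x t| ≤ M * B ^ q := by
  have h1 := mul_max_rpow_le (δ := δ) hq ht.1
  have h2 := mul_max_rpow_nonneg (q := q) (δ := δ) ht.1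
  have h3 : t ^ q ≤ B ^ q := rpow_le_rpow ht.1 ht.2 hq.1.le
  have h4 : 0 ≤ t ^ q := rpow_nonneg ht.1 _
  have h5 := abs_le.1 hM
  have hM0 : 0 ≤ M := (abs_nonneg _).trans hM
  have h6 : M * t ^ q ≤ M * B ^ q := mul_le_mul_of_nonneg_left h3 hM0
  have p1 : max (A x) 0 * t ^ q ≤ M * t ^ q :=
    mul_le_mul_of_nonneg_right (max_le h5.2 hM0) h4
  have p2 : max (-A x) 0 * (t * max t δ ^ (q - 1)) ≤ M * t ^ q :=
    mul_le_mul (max_le (by linarith) hM0) h1 h2 hM0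
  have p3 : 0 ≤ max (A x) 0 * t ^ q := mul_nonneg (le_max_right _ _) h4
  have p4 : 0 ≤ max (-A x) 0 * (t * max t δ ^ (q - 1)) := mul_nonneg (le_max_right _ _) h2
  rw [regNonlinearity, abs_le]
  constructor <;> linarith

lemma regNonlinearity_zero (hq : 0 < q) (x : ℝ) : regNonlinearity A q δ x 0 = 0 := by
  simp [regNonlinearity, zero_rpow hq.ne']

lemma regNonlinearity_of_nonneg {x : ℝ} (hx : 0 ≤ A x) (t : ℝ) :
    regNonlinearity A q δ x t = A x * t ^ q := by
  simp [regNonlinearity, max_eq_left hx, max_eq_right (neg_nonpos.2 hx)]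

lemma regNonlinearity_add_mul_mono (hq : q ∈ Ioo (0 : ℝ) 1) (hδ : 0 < δ) {M k x t r : ℝ}
    (hM : |A x| ≤ M) (hk : M * δ ^ (q - 1) ≤ k) (ht : 0 ≤ t) (htr : t ≤ r) :
    regNonlinearity A q δ x t + k * t ≤ regNonlinearity A q δ x r + k * r := by
  have hr := ht.trans htr
  have hM0 : 0 ≤ M := (abs_nonneg _).trans hM
  have h1 : max (A x) 0 * t ^ q ≤ max (A x) 0 * r ^ q :=
    mul_le_mul_of_nonneg_left (rpow_le_rpow ht htr hq.1.le) (le_max_right _ _)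
  have h2 : max r δ ^ (q - 1) ≤ max t δ ^ (q - 1) :=
    rpow_le_rpow_of_nonpos (lt_max_of_lt_right hδ) (max_le_max_right _ htr) (by linarith [hq.2])
  have h3 : max t δ ^ (q - 1) ≤ δ ^ (q - 1) :=
    rpow_le_rpow_of_nonpos hδ (le_max_right _ _) (by linarith [hq.2])
  have h4 : 0 ≤ max (-A x) 0 := le_max_right _ _
  have h5 : max (-A x) 0 ≤ M := max_le (by linarith [(abs_le.1 hM).1]) hM0
  have h6 : max (-A x) 0 * max t δ ^ (q - 1) ≤ k :=
    (mul_le_mul h5 h3 (rpow_nonneg (ht.trans (le_max_left _ _)) _) hM0).trans hk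
  have h7 : t * (k - max (-A x) 0 * max t δ ^ (q - 1))
      ≤ r * (k - max (-A x) 0 * max r δ ^ (q - 1)) :=
    mul_le_mul htr (sub_le_sub_left (mul_le_mul_of_nonneg_left h2 h4) _)
      (sub_nonneg.2 h6) hr
  simp only [regNonlinearity]
  linarith

lemma tendsto_regNonlinearity (hq : q ∈ Ioo (0 : ℝ) 1) {δ t : ℕ → ℝ} {r : ℝ}
    (hδ : Tendsto δ atTop (𝓝 0)) (ht0 : ∀ n, 0 ≤ t n) (ht : Tendsto t atTop (𝓝 r)) (x : ℝ) :
    Tendsto (fun n => regNonlinearity A q (δ n) x (t n)) atTop (𝓝 (A x * r ^ q)) := by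
  have hr : 0 ≤ r := ge_of_tendsto ht (Eventually.of_forall ht0)
  have h1 : Tendsto (fun n => t n ^ q) atTop (𝓝 (r ^ q)) := ht.rpow_const (Or.inr hq.1.le)
  have h2 : Tendsto (fun n => t n * max (t n) (δ n) ^ (q - 1)) atTop (𝓝 (r ^ q)) := by
    rcases eq_or_lt_of_le hr with rfl | hr'
    · rw [zero_rpow hq.1.ne'] at h1 ⊢
      exact squeeze_zero (fun n => mul_max_rpow_nonneg (ht0 n))
        (fun n => mul_max_rpow_le hq (ht0 n)) h1
    · have hm : Tendsto (fun n => max (t n) (δ n)) atTop (𝓝 r) := by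
        simpa [max_eq_left hr] using ht.max hδ
      rw [rpow_eq_mul_rpow_sub_one hq.1 hr]
      exact ht.mul (hm.rpow_const (Or.inl hr'.ne'))
  have h3 := (h1.const_mul (max (A x) 0)).sub (h2.const_mul (max (-A x) 0))
  have h4 : A x * r ^ q = max (A x) 0 * r ^ q - max (-A x) 0 * r ^ q := by
    rw [← sub_mul]
    congr 1
    rcases le_total 0 (A x) with h | h <;> simp [h]
  rw [h4]
  exact h3

end regNonlinearity

/-- The method of sub- and supersolutions for `-u'' = A(x) u ^ q`. -/
lemma exists_sublinear_solution {L q M B : ℝ} (hL : 0 < L) (hq : q ∈ Ioo (0 : ℝ) 1)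
    {A : ℝ → ℝ} (hA : Continuous A) (hM : ∀ x, |A x| ≤ M) {φ s σ : ℝ → ℝ}
    (hφ : ∀ δ > 0, IsLowerBarrier L (regNonlinearity A q δ) φ) (hφ0 : ∀ x ∈ Icc 0 L, 0 ≤ φ x)
    (hs : HasNegSecondDeriv s σ) (hs0 : 0 ≤ s 0) (hsL : 0 ≤ s L)
    (hsf : ∀ x ∈ Icc 0 L, regNonlinearity A q 1 x (s x) ≤ σ x)
    (hφs : ∀ x ∈ Icc 0 L, φ x ≤ s x) (hsB : ∀ x ∈ Icc 0 L, s x ≤ B) :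
    ∃ u H, IsLinearSolution L u H ∧
      ∀ x ∈ Icc 0 L, φ x ≤ u x ∧ H x = A x * u x ^ q := by
  have hM0 : 0 ≤ M := (abs_nonneg _).trans (hM 0)
  have hstep : ∀ δ > 0, ∀ s σ : ℝ → ℝ, HasNegSecondDeriv s σ → 0 ≤ s 0 → 0 ≤ s L →
      (∀ x ∈ Icc 0 L, regNonlinearity A q δ x (s x) ≤ σ x) → (∀ x ∈ Icc 0 L, φ x ≤ s x) →
      (∀ x ∈ Icc 0 L, s x ≤ B) → ∃ u H, IsLinearSolution L u H ∧
        ∀ x ∈ Icc 0 L, φ x ≤ u x ∧ u x ≤ s x ∧ H x = regNonlinearity A q δ x (u x) := by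
    intro δ hδ s σ h1 h2 h3 h4 h5 h6
    have hp : 0 ≤ M * δ ^ (q - 1) := mul_nonneg hM0 (rpow_nonneg hδ.le _)
    exact exists_solution_between (k := M * δ ^ (q - 1) + 1) hL (by linarith)
      (continuous_regNonlinearity hA hq.1 hδ)
      (fun x _ t ht => abs_regNonlinearity_le hq (hM x) ht)
      (fun x _ t r ht htr => regNonlinearity_add_mul_mono hq hδ (hM x) (by linarith) ht htr)
      (hφ δ hδ) hφ0 h1 h2 h3 h4 h5 h6
  set δ : ℕ → ℝ := fun n => 1 / ((n : ℝ) + 1) with hδdef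
  have hδ : ∀ n, 0 < δ n := fun n => Nat.one_div_pos_of_nat
  have hδa : ∀ n, δ (n + 1) ≤ δ n := fun n => Nat.one_div_le_one_div (Nat.le_succ n)
  let P : ℕ → ((ℝ → ℝ) × (ℝ → ℝ)) → Prop := fun n p => IsLinearSolution L p.1 p.2 ∧
    ∀ x ∈ Icc 0 L, φ x ≤ p.1 x ∧ p.1 x ≤ B ∧ p.2 x = regNonlinearity A q (δ n) x (p.1 x)
  have hzero : ∃ p, P 0 p := by
    obtain ⟨u, H, hu, h⟩ := hstep (δ 0) (hδ 0) s σ hs hs0 hsL (by simpa [hδdef] using hsf) hφs hsB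
    exact ⟨(u, H), hu, fun x hx => ⟨(h x hx).1, (h x hx).2.1.trans (hsB x hx), (h x hx).2.2⟩⟩
  have hsucc : ∀ n p, P n p → ∃ p', P (n + 1) p' ∧ ∀ x ∈ Icc 0 L, p'.1 x ≤ p.1 x := by
    rintro n ⟨v, G⟩ ⟨hv, hvG⟩
    obtain ⟨u, H, hu, h⟩ := hstep (δ (n + 1)) (hδ _) v G hv.1 hv.2.2.1.ge hv.2.2.2.ge
      (fun x hx =>
        (regNonlinearity_le_of_le hq.2 (hδ _) (hδa n) x
          ((hφ0 x hx).trans (hvG x hx).1)).trans_eq (hvG x hx).2.2.symm)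
      (fun x hx => (hvG x hx).1) (fun x hx => (hvG x hx).2.1)
    exact ⟨(u, H), ⟨hu, fun x hx =>
      ⟨(h x hx).1, (h x hx).2.1.trans (hvG x hx).2.1, (h x hx).2.2⟩⟩, fun x hx => (h x hx).2.1⟩
  obtain ⟨p₀, hp₀⟩ := hzero
  choose! N hN hN' using hsucc
  let z : ℕ → (ℝ → ℝ) × (ℝ → ℝ) := fun n => Nat.rec p₀ (fun n p => N n p) n
  have hz : ∀ n, P n (z n) := fun n => by
    induction n with
    | zero => exact hp₀
    | succ n ih => exact hN n _ ih
  have hA' : ∀ x ∈ Icc 0 L, Antitone fun n => (z n).1 x := fun x hx =>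
    antitone_nat_of_succ_le fun n => hN' n _ (hz n) x hx
  have hlim : ∀ x ∈ Icc 0 L, Tendsto (fun n => (z n).1 x) atTop (𝓝 (⨅ n, (z n).1 x)) :=
    fun x hx => tendsto_atTop_ciInf (hA' x hx)
      ⟨φ x, by rintro _ ⟨n, rfl⟩; exact ((hz n).2 x hx).1⟩
  have hpos : ∀ n, ∀ x ∈ Icc 0 L, 0 ≤ (z n).1 x := fun n x hx =>
    (hφ0 x hx).trans ((hz n).2 x hx).1
  obtain ⟨u, H, hu, huw⟩ := exists_isLinearSolution_of_tendsto (F := fun x t => A x * t ^ q)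
    (C := M * B ^ q) hL (fun n => (hz n).1)
    (fun n x hx => by
      rw [((hz n).2 x hx).2.2]
      exact abs_regNonlinearity_le hq (hM x) ⟨hpos n x hx, ((hz n).2 x hx).2.1⟩)
    hlim ((hA.comp continuous_fst).mul ((continuous_rpow_const hq.1.le).comp continuous_snd))
    (fun x hx => by
      simp_rw [fun n => ((hz n).2 x hx).2.2]
      exact tendsto_regNonlinearity hq tendsto_one_div_add_atTop_nhds_zero_nat
        (fun n => hpos n x hx) (hlim x hx) x)
  refine ⟨u, H, hu, fun x hx => ⟨?_, (huw x hx).2⟩⟩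
  rw [(huw x hx).1]
  exact ge_of_tendsto (hlim x hx) (Eventually.of_forall fun n => ((hz n).2 x hx).1)

/-- A continuous function positive at a point of `[0, L]` is bounded below by a positive
constant on a nondegenerate subinterval. -/
lemma exists_Icc_le_of_pos {L : ℝ} (hL : 0 < L) {A : ℝ → ℝ} (hA : Continuous A) {y : ℝ}
    (hy : y ∈ Icc 0 L) (hAy : 0 < A y) :
    ∃ c d m, 0 ≤ c ∧ c < d ∧ d ≤ L ∧ 0 < m ∧ ∀ x ∈ Icc c d, m ≤ A x := by
  have hev : ∀ᶠ x in 𝓝 y, A y / 2 < A x :=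
    hA.continuousAt.eventually (lt_mem_nhds (half_lt_self hAy))
  obtain ⟨r, hr, hball⟩ := Metric.eventually_nhds_iff.1 hev
  refine ⟨max 0 (y - r / 2), min L (y + r / 2), A y / 2, le_max_left _ _, ?_, min_le_left _ _,
    half_pos hAy, fun x hx => (hball ?_).le⟩
  · exact max_lt (lt_min hL (by linarith [hy.1])) (lt_min (by linarith [hy.2]) (by linarith))
  · have h1 := (le_max_right _ _).trans hx.1
    have h2 := hx.2.trans (min_le_right _ _)
    rw [Real.dist_eq, abs_lt]
    constructor <;> linarith

lemma exists_pos_mul_le_mul_rpow {q m l : ℝ} (hq : q < 1) (hm : 0 < m) (hl : 0 < l) :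
    ∃ ε > 0, ∀ t ∈ Icc 0 ε, l * t ≤ m * t ^ q := by
  have hq' : 0 < 1 - q := sub_pos.2 hq
  refine ⟨(m / l) ^ (1 - q)⁻¹, rpow_pos_of_pos (div_pos hm hl) _, fun t ht => ?_⟩
  rcases eq_or_lt_of_le ht.1 with rfl | ht0
  · simpa using mul_nonneg hm.le (rpow_nonneg le_rfl q)
  have h1 : t ^ (1 - q) ≤ m / l := by
    refine (rpow_le_rpow ht.1 ht.2 hq'.le).trans_eq ?_
    rw [← rpow_mul (div_pos hm hl).le, inv_mul_cancel₀ hq'.ne', rpow_one]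
  have h2 : t = t ^ (1 - q) * t ^ q := by rw [← rpow_add ht0]; simp
  calc l * t = l * t ^ (1 - q) * t ^ q := by rw [mul_assoc, ← h2]
    _ ≤ m * t ^ q := mul_le_mul_of_nonneg_right
        (by rwa [le_div_iff₀' hl] at h1) (rpow_nonneg ht.1 _)

lemma exists_mul_rpow_le {q : ℝ} (hq : q < 1) (C ε : ℝ) :
    ∃ K > 0, ε ≤ K ∧ C * K ^ q ≤ K := by
  have h1 := (tendsto_rpow_atTop (sub_pos.2 hq)).eventually_ge_atTop C
  obtain ⟨K, hC, hK, hε⟩ :=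
    (h1.and ((eventually_gt_atTop 0).and (eventually_ge_atTop ε))).exists
  refine ⟨K, hK, hε, ?_⟩
  calc C * K ^ q ≤ K ^ (1 - q) * K ^ q :=
        mul_le_mul_of_nonneg_right hC (rpow_nonneg hK.le _)
    _ = K := by rw [← rpow_add hK]; simp

/-- Existence of a nontrivial solution for the one-dimensional Dirichlet problem with a
sign-changing continuous weight. -/
theorem stmt_5 (L q : ℝ) (hL : 0 < L) (hq : q ∈ Set.Ioo (0 : ℝ) 1)
    (a : ℝ → ℝ) (ha : ContinuousOn a (Set.Icc 0 L)) (hsign : ChangesSign L a) :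
    ∃ u u' u'' : ℝ → ℝ,
      DirichletSolution L q a u u' u'' ∧ ∃ x ∈ Set.Icc (0 : ℝ) L, u x ≠ 0 := by
  obtain ⟨y, hy, hay⟩ := hsign.1
  set A : ℝ → ℝ := IccExtend hL.le ((Icc 0 L).domRestrict a) with hAdef
  have hAa : ∀ x ∈ Icc 0 L, A x = a x := fun x hx => by
    rw [hAdef, IccExtend_of_mem _ _ hx]; rfl
  have hA : Continuous A := ha.domRestrict.Icc_extend'
  obtain ⟨M, hM⟩ : ∃ M, ∀ x, |A x| ≤ M := by
    obtain ⟨M, hM⟩ := isCompact_Icc.exists_bound_of_continuousOn ha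
    exact ⟨M, fun x => hM _ (projIcc 0 L hL.le x).2⟩
  obtain ⟨c, d, m, hc, hcd, hd, hm, hmA⟩ := exists_Icc_le_of_pos hL hA hy (by rwa [hAa y hy])
  obtain ⟨ε, hε, hεm⟩ := exists_pos_mul_le_mul_rpow hq.2 hm
    (pow_pos (div_pos pi_pos (sub_pos.2 hcd)) 2)
  obtain ⟨K, hK, hεK, hKM⟩ := exists_mul_rpow_le hq.2 (M * (L ^ 2 + 1) ^ q) ε
  have hs : HasNegSecondDeriv (fun x => K * (x * (L - x) + 1)) (fun _ => 2 * K) := by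
    refine ⟨fun x => K * (L - 2 * x), fun x => ?_, fun x => ?_⟩
    · exact ((((hasDerivAt_id x).mul ((hasDerivAt_id x).const_sub L)).add_const
        1).const_mul K).congr_deriv (by simp only [id_eq]; ring)
    · exact ((((hasDerivAt_id x).const_mul 2).const_sub L).const_mul K).congr_deriv (by ring)
  have hsK : ∀ x ∈ Icc 0 L, K ≤ K * (x * (L - x) + 1) := fun x hx =>
    le_mul_of_one_le_right hK.le (by nlinarith [mul_nonneg hx.1 (sub_nonneg.2 hx.2)])
  have hsB : ∀ x ∈ Icc 0 L, K * (x * (L - x) + 1) ≤ (L ^ 2 + 1) * K := fun x hx => by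
    rw [mul_comm]
    exact mul_le_mul_of_nonneg_right (by nlinarith [hx.1, hx.2]) hK.le
  obtain ⟨u, H, ⟨⟨u', h1, h2⟩, hHc, hu0, huL⟩, hu⟩ :=
    exists_sublinear_solution (φ := sineArch c d ε) hL hq hA hM
      (fun δ _ => isLowerBarrier_sineArch hc hcd hd hε.le
        (fun x _ => regNonlinearity_zero hq.1 x)
        (fun x hx t ht => by
          rw [regNonlinearity_of_nonneg (hm.le.trans (hmA x hx))]
          exact (hεm t ht).trans
            (mul_le_mul_of_nonneg_right (hmA x hx) (rpow_nonneg ht.1 _))))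
      (fun x _ => sineArch_nonneg hε.le x) hs (by simpa using hK.le) (by simpa using hK.le)
      (fun x hx => by
        have h := abs_regNonlinearity_le (δ := 1) hq (hM x)
          ⟨hK.le.trans (hsK x hx), hsB x hx⟩
        rw [mul_rpow (by positivity) hK.le, ← mul_assoc] at h
        linarith [le_abs_self (regNonlinearity A q 1 x (K * (x * (L - x) + 1)))])
      (fun x hx => (sineArch_le hε.le x).trans (hεK.trans (hsK x hx))) hsB
  refine ⟨u, u', fun x => -H x, ⟨fun x _ => (h1 x).hasDerivWithinAt,
    fun x _ => (h2 x).hasDerivWithinAt, hHc.neg.continuousOn,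
    fun x hx => (sineArch_nonneg hε.le x).trans (hu x hx).1, hu0, huL, fun x hx => ?_⟩,
    (c + d) / 2, ⟨by linarith, by linarith⟩, ?_⟩
  · rw [neg_neg, (hu x hx).2, hAa x hx]
  · have := (hu ((c + d) / 2) ⟨by linarith, by linarith⟩).1
    rw [sineArch_midpoint hcd] at this
    exact (hε.trans_le this).ne'
end

section
/- (Existence of a nontrivial solution for the one-dimensional Neumann problem under condition (A.0).) Let L > 0, q ∈ (0,1), and let a : [0,L] → ℝ be continuous, change sign, and satisfy ∫₀^L a(x) dx < 0. Then the Neumann problem (P_N) has at least one nontrivial solution, i.e. there exists a twice continuously differentiable u : [0,L] → ℝ, not identically zero, with u ≥ 0 on [0,L], u'(0) = u'(L) = 0, and −u''(x) = a(x)·u(x)^q for all x ∈ [0,L]. -/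
open Real Set

/-- `u` (with first and second derivatives `u'`, `u''`) is a solution of the
one-dimensional Neumann problem `(P_N)` on `[0, L]` with weight `a` and exponent `q`:
`u` is twice continuously differentiable on `[0, L]`, nonnegative, has vanishing
derivative at the endpoints, and satisfies `-u'' = a(x) u^q` on `[0, L]`. -/
def NeumannSolution (L q : ℝ) (a u u' u'' : ℝ → ℝ) : Prop :=
  (∀ x ∈ Set.Icc (0 : ℝ) L, HasDerivWithinAt u (u' x) (Set.Icc 0 L) x) ∧
  (∀ x ∈ Set.Icc (0 : ℝ) L, HasDerivWithinAt u' (u'' x) (Set.Icc 0 L) x) ∧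
  ContinuousOn u'' (Set.Icc 0 L) ∧
  (∀ x ∈ Set.Icc (0 : ℝ) L, 0 ≤ u x) ∧
  u' 0 = 0 ∧ u' L = 0 ∧
  (∀ x ∈ Set.Icc (0 : ℝ) L, -u'' x = a x * u x ^ q)

open Filter Topology MeasureTheory intervalIntegral

theorem hasDerivAt_max_zero_rpow {p : ℝ} (hp : 1 < p) (s : ℝ) :
    HasDerivAt (fun t : ℝ => max t 0 ^ p) (p * max s 0 ^ (p - 1)) s := by
  rcases lt_trichotomy s 0 with hs | rfl | hs
  · rw [max_eq_right hs.le, zero_rpow (by linarith), mul_zero]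
    refine (hasDerivAt_const s (0 : ℝ)).congr_of_eventuallyEq ?_
    filter_upwards [Iio_mem_nhds hs] with t ht
    rw [max_eq_right (le_of_lt ht), zero_rpow (by linarith)]
  · have h : HasDerivAt (fun t : ℝ => t ^ p) 0 0 := by
      simpa [zero_rpow (show p - 1 ≠ 0 by linarith)] using
        hasDerivAt_rpow_const (x := (0 : ℝ)) (p := p) (Or.inr hp.le)
    have h0 : (fun t : ℝ => |t| ^ p) =o[𝓝 0] fun t => t := by
      have := (h.isLittleO.comp_tendsto (k := fun t : ℝ => |t|)
        (by simpa using (continuous_abs.tendsto (0 : ℝ))))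
      rw [← Asymptotics.isLittleO_norm_right]
      simpa [Function.comp_def, zero_rpow (show p ≠ 0 by linarith)] using this
    rw [max_self, zero_rpow (by linarith), mul_zero, hasDerivAt_iff_isLittleO]
    simp only [max_self, zero_rpow (show p ≠ 0 by linarith), sub_zero, smul_zero]
    refine (Asymptotics.IsBigO.of_bound 1 (Eventually.of_forall fun t => ?_)).trans_isLittleO h0
    rw [one_mul, norm_of_nonneg (by positivity), norm_of_nonneg (by positivity)]
    exact rpow_le_rpow (le_max_right _ _) (max_le (le_abs_self t) (abs_nonneg t)) (by linarith)
  · rw [max_eq_left hs.le]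
    refine (hasDerivAt_rpow_const (Or.inl hs.ne')).congr_of_eventuallyEq ?_
    filter_upwards [Ioi_mem_nhds hs] with t ht
    rw [max_eq_left (le_of_lt ht)]

theorem continuous_max_zero_rpow {p : ℝ} (hp : 0 ≤ p) :
    Continuous fun t : ℝ => max t 0 ^ p :=
  (continuous_id.max continuous_const).rpow_const fun _ => Or.inr hp

theorem abs_max_zero_rpow_sub_le {p M s t : ℝ} (hp : 1 < p) (hs : s ≤ M) (ht : t ≤ M) (hM : 0 ≤ M) :
    |max t 0 ^ p - max s 0 ^ p| ≤ p * M ^ (p - 1) * |t - s| := by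
  refine (convex_Iic M).norm_image_sub_le_of_norm_hasDerivWithin_le
    (fun x _ => (hasDerivAt_max_zero_rpow hp x).hasDerivWithinAt) (fun x hx => ?_) hs ht
  rw [norm_of_nonneg (by positivity)]
  have : max x 0 ^ (p - 1) ≤ M ^ (p - 1) :=
    rpow_le_rpow (le_max_right _ _) (max_le hx hM) (by linarith)
  gcongr

theorem exists_subseq_weakly_tendsto {H : Type*} [NormedAddCommGroup H] [InnerProductSpace ℝ H]
    [CompleteSpace H] [TopologicalSpace.SeparableSpace H] {R : ℝ} {v : ℕ → H}
    (hv : ∀ n, ‖v n‖ ≤ R) :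
    ∃ (w : H) (φ : ℕ → ℕ), StrictMono φ ∧
      ∀ h : H, Tendsto (fun n => inner ℝ h (v (φ n))) atTop (𝓝 (inner ℝ h w)) := by
  obtain ⟨w, -, φ, hφ, hlim⟩ := WeakDual.isSeqCompact_closedBall ℝ H (0 : StrongDual ℝ H) R
    (x := fun n => StrongDual.toWeakDual (InnerProductSpace.toDual ℝ H (v n)))
    (fun n => by simpa using hv n)
  refine ⟨(InnerProductSpace.toDual ℝ H).symm (WeakDual.toStrongDual w), φ, hφ, fun h => ?_⟩
  have := ((WeakDual.eval_continuous h).tendsto w).comp hlim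
  rw [real_inner_comm, InnerProductSpace.toDual_symm_apply]
  refine this.congr fun n => ?_
  simp [real_inner_comm]

theorem norm_le_of_weakly_tendsto {H : Type*} [NormedAddCommGroup H] [InnerProductSpace ℝ H]
    {v : ℕ → H} {w : H} {l : ℝ}
    (hw : Tendsto (fun n => inner ℝ w (v n)) atTop (𝓝 (inner ℝ w w)))
    (hl : Tendsto (fun n => ‖v n‖ ^ 2) atTop (𝓝 l)) : ‖w‖ ^ 2 ≤ l := by
  have h : ∀ n, 2 * inner ℝ w (v n) - ‖w‖ ^ 2 ≤ ‖v n‖ ^ 2 := fun n => by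
    have := norm_sub_sq_real (v n) w
    rw [real_inner_comm] at this
    nlinarith [sq_nonneg ‖v n - w‖]
  have := le_of_tendsto_of_tendsto' ((hw.const_mul 2).sub_const (‖w‖ ^ 2)) hl h
  rw [real_inner_self_eq_norm_sq] at this
  linarith

/-- The direct method for `κ ‖v‖² - Φ c v` on `ℝ × H`, where `Φ` is sequentially weakly continuous
and of subquadratic growth in `v`, and `c` is controlled by `‖v‖` wherever `Φ` is positive. -/
theorem exists_minimizer_of_weakly_continuous {H : Type*} [NormedAddCommGroup H]
    [InnerProductSpace ℝ H] [CompleteSpace H] [TopologicalSpace.SeparableSpace H]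
    {Φ : ℝ → H → ℝ} {κ K C p : ℝ} (hκ : 0 < κ) (hC : 0 ≤ C) (hp : 0 < p) (hp2 : p < 2)
    (hΦ : ∀ (c : ℕ → ℝ) (v : ℕ → H) (c₀ : ℝ) (v₀ : H), Tendsto c atTop (𝓝 c₀) →
      (∀ h, Tendsto (fun n => inner ℝ h (v n)) atTop (𝓝 (inner ℝ h v₀))) →
      (∃ R, ∀ n, ‖v n‖ ≤ R) → Tendsto (fun n => Φ (c n) (v n)) atTop (𝓝 (Φ c₀ v₀)))
    (hcK : ∀ c v, 0 < Φ c v → |c| ≤ K * ‖v‖) (hup : ∀ c v, Φ c v ≤ C * ‖v‖ ^ p)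
    (hneg : ∃ c v, κ * ‖v‖ ^ 2 < Φ c v) :
    ∃ c v, κ * ‖v‖ ^ 2 < Φ c v ∧
      ∀ c' v', κ * ‖v‖ ^ 2 - Φ c v ≤ κ * ‖v'‖ ^ 2 - Φ c' v' := by
  set J : ℝ × H → ℝ := fun z => κ * ‖z.2‖ ^ 2 - Φ z.1 z.2 with hJ
  set R : ℝ := (C / κ) ^ (2 - p)⁻¹ with hR
  have hR0 : 0 ≤ R := by positivity
  have hbound : ∀ z : ℝ × H, J z < 0 → ‖z.2‖ ≤ R := fun z hz => by
    rcases (norm_nonneg z.2).eq_or_lt with h | h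
    · rwa [← h]
    · have h1 : κ * ‖z.2‖ ^ 2 < C * ‖z.2‖ ^ p := (sub_neg.1 hz).trans_le (hup _ _)
      have h2 : ‖z.2‖ ^ (2 - p) ≤ C / κ := by
        rw [rpow_sub h, rpow_two, div_le_div_iff₀ (by positivity) hκ]
        linarith
      rw [hR, Real.le_rpow_inv_iff_of_pos h.le (by positivity) (by linarith)]
      exact h2
  have hbound' : ∀ z : ℝ × H, J z < 0 → |z.1| ≤ |K| * R := fun z hz => by
    have h0 : 0 < Φ z.1 z.2 := by have := sub_neg.1 hz; nlinarith [sq_nonneg ‖z.2‖]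
    calc |z.1| ≤ K * ‖z.2‖ := hcK _ _ h0
      _ ≤ |K| * ‖z.2‖ := by gcongr; exact le_abs_self K
      _ ≤ |K| * R := by gcongr; exact hbound z hz
  set S : Set ℝ := J '' {z | J z < 0} with hS
  have hSne : S.Nonempty := by
    obtain ⟨c, v, h⟩ := hneg
    exact ⟨_, (c, v), sub_neg.2 h, rfl⟩
  have hSb : BddBelow S := by
    refine ⟨-(C * R ^ p), ?_⟩
    rintro _ ⟨z, hz, rfl⟩
    have h1 : C * ‖z.2‖ ^ p ≤ C * R ^ p := by
      gcongr; exact hbound z hz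
    have h2 := hup z.1 z.2
    have h3 : 0 ≤ κ * ‖z.2‖ ^ 2 := by positivity
    simp only [hJ]; linarith
  obtain ⟨y, -, hylim, hyS⟩ := exists_seq_tendsto_sInf hSne hSb
  choose z hz hzy using hyS
  obtain ⟨v₀, φ, hφ, hv₀⟩ := exists_subseq_weakly_tendsto (fun n => hbound _ (hz n))
  obtain ⟨c₀, -, ψ, hψ, hc₀⟩ := tendsto_subseq_of_bounded (Metric.isBounded_closedBall
    (x := (0 : ℝ)) (r := |K| * R)) (x := fun n => (z (φ n)).1)
    (fun n => by simpa using hbound' _ (hz (φ n)))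
  have hv₁ : ∀ h, Tendsto (fun n => inner ℝ h (z (φ (ψ n))).2) atTop (𝓝 (inner ℝ h v₀)) :=
    fun h => (hv₀ h).comp hψ.tendsto_atTop
  have hlimΦ := hΦ _ _ c₀ v₀ hc₀ hv₁ ⟨R, fun n => hbound _ (hz _)⟩
  have hlimJ : Tendsto (fun n => J (z (φ (ψ n)))) atTop (𝓝 (sInf S)) := by
    simpa only [Function.comp_def, hzy] using hylim.comp (hφ.comp hψ).tendsto_atTop
  have hnorm : Tendsto (fun n => ‖(z (φ (ψ n))).2‖ ^ 2) atTop
      (𝓝 ((sInf S + Φ c₀ v₀) / κ)) := by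
    refine ((hlimJ.add hlimΦ).div_const κ).congr fun n => ?_
    simp only [hJ, Function.comp_apply]; field_simp; ring
  have hle := norm_le_of_weakly_tendsto (hv₁ v₀) hnorm
  rw [le_div_iff₀ hκ] at hle
  have hmin : ∀ c v, J (c, v) < 0 → κ * ‖v₀‖ ^ 2 - Φ c₀ v₀ ≤ J (c, v) := fun c v h => by
    have := csInf_le hSb ⟨(c, v), h, rfl⟩
    linarith
  have hneg₀ : κ * ‖v₀‖ ^ 2 - Φ c₀ v₀ < 0 := by
    obtain ⟨c, v, h⟩ := hneg
    exact (hmin c v (sub_neg.2 h)).trans_lt (sub_neg.2 h)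
  refine ⟨c₀, v₀, sub_neg.1 hneg₀, fun c v => ?_⟩
  rcases lt_or_ge (J (c, v)) 0 with h | h
  · exact hmin c v h
  · exact hneg₀.le.trans h

/-- The indicators of `(0, x]` in `L²(ℝ)` realise the kernel `min x y`. -/
theorem exists_continuous_inner_eq_min :
    ∃ e : ℝ → Lp ℝ 2 (volume : Measure ℝ), Continuous e ∧
      ∀ x y, 0 ≤ x → 0 ≤ y → inner ℝ (e x) (e y) = min x y := by
  have hfin : ∀ x : ℝ, volume (Ioc 0 x) ≠ ⊤ := fun x => by simp
  set e : ℝ → Lp ℝ 2 (volume : Measure ℝ) := fun x =>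
    indicatorConstLp 2 measurableSet_Ioc (hfin x) (1 : ℝ) with he
  have hinner : ∀ x y, inner ℝ (e x) (e y) = max (min x y) 0 := fun x y => by
    rw [he, L2.inner_indicatorConstLp_indicatorConstLp measurableSet_Ioc measurableSet_Ioc
      (hfin x) (hfin y), Ioc_inter_Ioc, max_self, Measure.real, Real.volume_Ioc, sub_zero,
      ENNReal.toReal_ofReal']
    simp
  refine ⟨e, ?_, fun x y hx hy => by rw [hinner, max_eq_left (le_min hx hy)]⟩
  rw [continuous_iff_continuousAt]
  intro x
  rw [ContinuousAt, tendsto_iff_norm_sub_tendsto_zero]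
  have hsq : ∀ y, ‖e y - e x‖ ^ 2 = max y 0 - 2 * max (min y x) 0 + max x 0 := fun y => by
    rw [norm_sub_sq_real, ← real_inner_self_eq_norm_sq, ← real_inner_self_eq_norm_sq, hinner,
      hinner, hinner, min_self, min_self]
  have hc : Continuous fun y => √(max y 0 - 2 * max (min y x) 0 + max x 0) := by fun_prop
  have := hc.tendsto x
  simp only [min_self, ← hsq, sqrt_sq (norm_nonneg _)] at this
  convert this using 2
  rw [show max x 0 - 2 * max x 0 + max x 0 = 0 by ring, sqrt_zero]

theorem abs_le_of_integral_mul_max_rpow_pos {L p c r : ℝ} {a τ : ℝ → ℝ} (hL : 0 < L) (hp : 1 < p)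
    (ha : Continuous a) (hneg : (∫ x in (0 : ℝ)..L, a x) < 0) (hτ : Continuous τ)
    (hr : ∀ x ∈ Icc 0 L, |τ x| ≤ r)
    (hpos : 0 < ∫ x in (0 : ℝ)..L, a x * max (c + τ x) 0 ^ p) :
    |c| ≤ max 1 (p * 2 ^ (p - 1) * (∫ x in (0 : ℝ)..L, |a x|) / -∫ x in (0 : ℝ)..L, a x) * r := by
  set M := ∫ x in (0 : ℝ)..L, |a x| with hM
  set A := ∫ x in (0 : ℝ)..L, a x with hA
  set K := max 1 (p * 2 ^ (p - 1) * M / -A) with hK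
  have hr0 : 0 ≤ r := (abs_nonneg _).trans (hr 0 ⟨le_rfl, hL.le⟩)
  have hrK : r ≤ K * r := le_mul_of_one_le_left hr0 (le_max_left _ _)
  have hM0 : 0 ≤ M := integral_nonneg hL.le fun x _ => abs_nonneg _
  have hcont : Continuous fun x => max (c + τ x) 0 ^ p :=
    (continuous_max_zero_rpow (by linarith)).comp (continuous_const.add hτ)
  rw [abs_le]
  constructor
  · by_contra! h
    refine hpos.ne' (integral_zero_ae (Eventually.of_forall fun x hx => ?_))
    rw [uIoc_of_le hL.le] at hx
    have := (abs_le.1 (hr x (Ioc_subset_Icc_self hx))).2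
    rw [max_eq_right (by linarith), zero_rpow (by linarith), mul_zero]
  · by_contra! h
    have hc0 : 0 < c := (hr0.trans hrK).trans_lt h
    have hbd : ∀ x ∈ Icc 0 L, a x * max (c + τ x) 0 ^ p ≤
        a x * c ^ p + |a x| * (p * (2 * c) ^ (p - 1) * r) := fun x hx => by
      have hx' := abs_le.1 (hr x hx)
      have h1 := abs_max_zero_rpow_sub_le (p := p) (M := 2 * c) (s := c) (t := c + τ x) hp
        (by linarith) (by linarith) (by linarith)
      rw [max_eq_left hc0.le, add_sub_cancel_left] at h1
      have h2 : p * (2 * c) ^ (p - 1) * |τ x| ≤ p * (2 * c) ^ (p - 1) * r := by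
        gcongr; exact hr x hx
      calc a x * max (c + τ x) 0 ^ p = a x * c ^ p + a x * (max (c + τ x) 0 ^ p - c ^ p) := by ring
        _ ≤ a x * c ^ p + |a x| * |max (c + τ x) 0 ^ p - c ^ p| := by
          rw [← abs_mul]; gcongr; exact le_abs_self _
        _ ≤ _ := by gcongr; exact h1.trans h2
    have hint := integral_mono_on (μ := volume) hL.le ((ha.mul hcont).intervalIntegrable 0 L)
      (Continuous.intervalIntegrable (by fun_prop) 0 L) hbd
    rw [intervalIntegral.integral_add (Continuous.intervalIntegrable (by fun_prop) 0 L)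
      (Continuous.intervalIntegrable (by fun_prop) 0 L), intervalIntegral.integral_mul_const,
      intervalIntegral.integral_mul_const, ← hM, ← hA, mul_rpow (by norm_num) hc0.le] at hint
    have hcp : c ^ p = c ^ (p - 1) * c := by
      rw [← rpow_add_one hc0.ne', sub_add_cancel]
    have h3 : p * 2 ^ (p - 1) * M * r ≤ -A * c := by
      have : p * 2 ^ (p - 1) * M ≤ K * -A := (div_le_iff₀ (by linarith)).1 (le_max_right _ _)
      nlinarith
    have h4 : 0 < c ^ (p - 1) := by positivity
    rw [hcp] at hint
    have h5 : A * (c ^ (p - 1) * c) + M * (p * (2 ^ (p - 1) * c ^ (p - 1)) * r) =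
      c ^ (p - 1) * (p * 2 ^ (p - 1) * M * r - -A * c) := by ring
    rw [h5] at hint
    have := mul_nonpos_of_nonneg_of_nonpos h4.le (sub_nonpos.2 h3)
    exact hpos.not_ge (hint.trans this)

theorem integral_mul_max_rpow_le {L p c r K : ℝ} {a τ : ℝ → ℝ} (hL : 0 < L) (hp : 1 < p)
    (ha : Continuous a) (hτ : Continuous τ) (hr : ∀ x ∈ Icc 0 L, |τ x| ≤ r) (hc : |c| ≤ K * r) :
    ∫ x in (0 : ℝ)..L, a x * max (c + τ x) 0 ^ p ≤
      (∫ x in (0 : ℝ)..L, |a x|) * ((K + 1) * r) ^ p := by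
  have hcont : Continuous fun x => max (c + τ x) 0 ^ p :=
    (continuous_max_zero_rpow (by linarith)).comp (continuous_const.add hτ)
  have hr0 : 0 ≤ r := (abs_nonneg _).trans (hr 0 ⟨le_rfl, hL.le⟩)
  rw [← intervalIntegral.integral_mul_const]
  refine integral_mono_on hL.le ((ha.mul hcont).intervalIntegrable 0 L)
    (Continuous.intervalIntegrable (by fun_prop) 0 L) fun x hx => ?_
  have h : max (c + τ x) 0 ≤ (K + 1) * r := by
    have h1 := (abs_le.1 (hr x hx)).2
    have h2 := (abs_le.1 hc).2
    exact max_le (by linarith) (by linarith [abs_nonneg c])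
  calc a x * max (c + τ x) 0 ^ p ≤ |a x| * max (c + τ x) 0 ^ p := by gcongr; exact le_abs_self _
    _ ≤ _ := by gcongr

theorem tendsto_integral_mul_max_rpow {L p B : ℝ} {a : ℝ → ℝ} {u : ℕ → ℝ → ℝ} {u₀ : ℝ → ℝ}
    (hL : 0 < L) (hp : 1 < p) (ha : Continuous a) (hu : ∀ n, Continuous (u n))
    (hB : ∀ᶠ n in atTop, ∀ x ∈ Icc 0 L, u n x ≤ B)
    (hlim : ∀ x ∈ Icc 0 L, Tendsto (fun n => u n x) atTop (𝓝 (u₀ x))) :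
    Tendsto (fun n => ∫ x in (0 : ℝ)..L, a x * max (u n x) 0 ^ p) atTop
      (𝓝 (∫ x in (0 : ℝ)..L, a x * max (u₀ x) 0 ^ p)) := by
  have hcont := continuous_max_zero_rpow (p := p) (by linarith)
  refine intervalIntegral.tendsto_integral_filter_of_dominated_convergence
    (fun x => |a x| * max B 0 ^ p)
    (Eventually.of_forall fun n => (ha.mul (hcont.comp (hu n))).aestronglyMeasurable) ?_
    (Continuous.intervalIntegrable (by fun_prop) 0 L) (Eventually.of_forall fun x hx => ?_)
  · filter_upwards [hB] with n hn
    refine Eventually.of_forall fun x hx => ?_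
    rw [uIoc_of_le hL.le] at hx
    rw [norm_mul, norm_eq_abs, norm_of_nonneg (r := max (u n x) 0 ^ p) (by positivity)]
    gcongr
    exact hn x (Ioc_subset_Icc_self hx)
  · rw [uIoc_of_le hL.le] at hx
    exact ((hcont.tendsto _).comp (hlim x (Ioc_subset_Icc_self hx))).const_mul _

theorem hasDerivAt_integral_mul_max_rpow {L p : ℝ} {a u φ : ℝ → ℝ} (hp : 1 < p)
    (ha : Continuous a) (hu : Continuous u) (hφ : Continuous φ) :
    HasDerivAt (fun t => ∫ x in (0 : ℝ)..L, a x * max (u x + t * φ x) 0 ^ p)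
      (p * ∫ x in (0 : ℝ)..L, a x * max (u x) 0 ^ (p - 1) * φ x) 0 := by
  have hcont := continuous_max_zero_rpow (p := p) (by linarith)
  have hcont' := continuous_max_zero_rpow (p := p - 1) (by linarith)
  have key := (hasDerivAt_integral_of_dominated_loc_of_deriv_le (μ := volume) (a := 0) (b := L)
    (F := fun t x => a x * max (u x + t * φ x) 0 ^ p)
    (F' := fun t x => a x * (p * max (u x + t * φ x) 0 ^ (p - 1) * φ x))
    (bound := fun x => |a x| * (p * (|u x| + |φ x|) ^ (p - 1) * |φ x|))
    (x₀ := 0) (s := Metric.ball 0 1) (Metric.ball_mem_nhds _ one_pos)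
    (Eventually.of_forall fun t => (ha.mul (hcont.comp (by fun_prop))).aestronglyMeasurable)
    ((ha.mul (hcont.comp (by fun_prop))).intervalIntegrable _ _)
    (ha.mul ((continuous_const.mul (hcont'.comp (by fun_prop))).mul hφ)).aestronglyMeasurable
    (Eventually.of_forall fun x _ t ht => ?_) ?_ (Eventually.of_forall fun x _ t _ => ?_)).2
  · rw [← intervalIntegral.integral_const_mul]
    refine key.congr_deriv (integral_congr fun x _ => ?_)
    simp only [zero_mul, add_zero]
    ring
  · have ht' : |t| ≤ 1 := by simpa using (mem_ball_zero_iff.1 ht).le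
    have h : max (u x + t * φ x) 0 ≤ |u x| + |φ x| := by
      refine max_le (add_le_add (le_abs_self _) ((le_abs_self _).trans ?_)) (by positivity)
      rw [abs_mul]
      exact mul_le_of_le_one_left (abs_nonneg _) ht'
    rw [norm_mul, norm_mul, norm_eq_abs, norm_eq_abs (φ x), norm_of_nonneg (by positivity)]
    have : max (u x + t * φ x) 0 ^ (p - 1) ≤ (|u x| + |φ x|) ^ (p - 1) :=
      rpow_le_rpow (le_max_right _ _) h (by linarith)
    gcongr
  · refine Continuous.intervalIntegrable ?_ _ _
    have : Continuous fun x => (|u x| + |φ x|) ^ (p - 1) :=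
      Continuous.rpow_const (by fun_prop) fun _ => Or.inr (by linarith)
    fun_prop
  · refine HasDerivAt.const_mul _ ?_
    have := ((hasDerivAt_id t).mul_const (φ x)).const_add (u x)
    rw [one_mul] at this
    exact (hasDerivAt_max_zero_rpow hp (u x + t * φ x)).comp t this

/-- A function which is affine where it is negative and has vanishing derivative at both endpoints
is either nonnegative or negative throughout. -/
theorem nonneg_or_neg_of_second_deriv_eq_zero {L : ℝ} {U U' U'' : ℝ → ℝ} (hL : 0 < L)
    (hU : ∀ y ∈ Icc 0 L, HasDerivAt U (U' y) y) (hU' : ∀ y ∈ Icc 0 L, HasDerivAt U' (U'' y) y)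
    (h0 : U' 0 = 0) (h1 : U' L = 0) (hU'' : ∀ y ∈ Icc 0 L, U y < 0 → U'' y = 0) :
    (∀ y ∈ Icc 0 L, 0 ≤ U y) ∨ ∀ y ∈ Icc 0 L, U y < 0 := by
  have hw : ∀ p : ℝ, 1 < p → ∀ y ∈ Icc 0 L,
      HasDerivAt (fun y => max (-U y) 0 ^ p) (p * max (-U y) 0 ^ (p - 1) * -U' y) y :=
    fun p hp y hy => HasDerivAt.comp (h := fun y => -U y) y (hasDerivAt_max_zero_rpow hp (-U y))
      (hU y hy).neg
  set W : ℝ → ℝ := fun y => max (-U y) 0 ^ (2 : ℝ) * U' y with hW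
  have hWd := fun y hy => (hw 2 one_lt_two y hy).mul (hU' y hy)
  have hWle : ∀ y ∈ Icc 0 L, 2 * max (-U y) 0 ^ ((2 : ℝ) - 1) * -U' y * U' y +
      max (-U y) 0 ^ (2 : ℝ) * U'' y ≤ 0 := fun y hy => by
    have h2 : max (-U y) 0 ^ (2 : ℝ) * U'' y = 0 := by
      rcases lt_or_ge (U y) 0 with h | h
      · rw [hU'' y hy h, mul_zero]
      · rw [max_eq_right (by linarith), zero_rpow two_ne_zero, zero_mul]
    have h3 : 0 ≤ max (-U y) 0 ^ ((2 : ℝ) - 1) := by positivity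
    rw [h2]
    nlinarith [mul_nonneg h3 (sq_nonneg (U' y))]
  have hanti : AntitoneOn W (Icc 0 L) := by
    refine antitoneOn_of_deriv_nonpos (convex_Icc 0 L)
      (fun y hy => (hWd y hy).continuousAt.continuousWithinAt)
      (fun y hy => (hWd y (interior_subset hy)).differentiableAt.differentiableWithinAt)
      fun y hy => ?_
    have hy' := interior_subset hy
    exact (hWd y hy').deriv.trans_le (hWle y hy')
  have hW0 : ∀ y ∈ Icc 0 L, W y = 0 := fun y hy => by
    have e0 : W 0 = 0 := by simp [hW, h0]
    have e1 : W L = 0 := by simp [hW, h1]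
    exact le_antisymm ((hanti ⟨le_rfl, hL.le⟩ hy hy.1).trans_eq e0)
      (e1.symm.trans_le (hanti hy ⟨hL.le, le_rfl⟩ hy.2))
  have hconst : ∀ y ∈ Icc 0 L, max (-U y) 0 ^ (3 : ℝ) = max (-U 0) 0 ^ (3 : ℝ) := by
    refine constant_of_has_deriv_right_zero
      (fun y hy => (hw 3 (by norm_num) y hy).continuousAt.continuousWithinAt) fun y hy => ?_
    have hy' := Ico_subset_Icc_self hy
    convert (hw 3 (by norm_num) y hy').hasDerivWithinAt using 1
    have := hW0 y hy'
    norm_num [hW] at this ⊢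
    tauto
  rcases lt_or_ge (U 0) 0 with h | h
  · right
    intro y hy
    by_contra! hy0
    have := hconst y hy
    rw [max_eq_right (by linarith), max_eq_left (by linarith), zero_rpow (by norm_num)] at this
    exact (rpow_pos_of_pos (neg_pos.2 h) 3).ne this
  · left
    intro y hy
    by_contra! hy0
    have := hconst y hy
    rw [max_eq_left (by linarith), max_eq_right (by linarith), zero_rpow (by norm_num)] at this
    exact (rpow_pos_of_pos (neg_pos.2 hy0) 3).ne' this

theorem hasDerivAt_integral_lower_limit {L : ℝ} {g : ℝ → ℝ} (hg : Continuous g) (y : ℝ) :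
    HasDerivAt (fun y => ∫ x in y..L, g x) (-g y) y :=
  integral_hasDerivAt_left (hg.intervalIntegrable _ _) (hg.stronglyMeasurableAtFilter _ _)
    hg.continuousAt

theorem integral_mul_min {L y : ℝ} {g : ℝ → ℝ} (hg : Continuous g) (hy : y ∈ Icc 0 L) :
    ∫ x in (0 : ℝ)..L, g x * min x y = (∫ x in (0 : ℝ)..y, g x * x) + y * ∫ x in y..L, g x := by
  rw [← integral_add_adjacent_intervals (b := y)
    (Continuous.intervalIntegrable (by fun_prop) _ _)
    (Continuous.intervalIntegrable (by fun_prop) _ _), ← intervalIntegral.integral_const_mul]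
  congr 1
  · refine integral_congr fun x hx => ?_
    rw [uIcc_of_le hy.1] at hx
    simp only [min_eq_left hx.2]
  · refine integral_congr fun x hx => ?_
    rw [uIcc_of_le hy.2] at hx
    simp only [min_eq_right hx.1, mul_comm]

theorem hasDerivAt_integral_mul_id_add_mul_integral {L : ℝ} {g : ℝ → ℝ} (hg : Continuous g) (y : ℝ) :
    HasDerivAt (fun y => (∫ x in (0 : ℝ)..y, g x * x) + y * ∫ x in y..L, g x)
      (∫ x in y..L, g x) y := by
  have h1 : Continuous fun x => g x * x := by fun_prop
  have h2 := (integral_hasDerivAt_right (h1.intervalIntegrable 0 y)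
    (h1.stronglyMeasurableAtFilter _ _) h1.continuousAt).add
    ((hasDerivAt_id y).mul (hasDerivAt_integral_lower_limit (L := L) hg y))
  refine h2.congr_deriv ?_
  simp only [id, one_mul]
  ring

section GreenKernel

variable {H : Type*} [NormedAddCommGroup H] [InnerProductSpace ℝ H] {e : ℝ → H} {L p : ℝ}
  {a : ℝ → ℝ}

theorem abs_inner_le_of_inner_eq_min
    (he : ∀ x y, 0 ≤ x → 0 ≤ y → inner ℝ (e x) (e y) = min x y) (v : H) {x : ℝ}
    (hx : x ∈ Icc 0 L) : |inner ℝ (e x) v| ≤ √L * ‖v‖ := by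
  have h : ‖e x‖ = √x := by
    rw [norm_eq_sqrt_real_inner, he x x hx.1 hx.1, min_self]
  refine (abs_real_inner_le_norm _ _).trans ?_
  rw [h]
  gcongr
  exact hx.2

theorem exists_integral_mul_max_inner_rpow_pos (hL : 0 < L) (hp : 1 < p) (ha : Continuous a)
    (hpos : ∃ x ∈ Icc 0 L, 0 < a x) (hec : Continuous e)
    (he : ∀ x y, 0 ≤ x → 0 ≤ y → inner ℝ (e x) (e y) = min x y) :
    ∃ v : H, 0 < ∫ x in (0 : ℝ)..L, a x * max (inner ℝ (e x) v) 0 ^ p := by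
  obtain ⟨x₀, hx₀, hax₀⟩ := hpos
  obtain ⟨δ, hδ, hball⟩ := Metric.eventually_nhds_iff.1 ((ha.tendsto x₀).eventually_const_lt hax₀)
  obtain ⟨α, hα⟩ : ∃ α, α = max 0 (x₀ - δ / 2) := ⟨_, rfl⟩
  obtain ⟨β, hβ⟩ : ∃ β, β = min L (x₀ + δ / 2) := ⟨_, rfl⟩
  have hα0 : 0 ≤ α := hα ▸ le_max_left _ _
  have hβL : β ≤ L := hβ ▸ min_le_left _ _
  have hαβ : α < β := by
    rw [hα, hβ, max_lt_iff, lt_min_iff, lt_min_iff]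
    refine ⟨⟨hL, ?_⟩, ?_, ?_⟩ <;> linarith [hx₀.1, hx₀.2]
  have hapos : ∀ x ∈ Icc α β, 0 < a x := fun x hx => by
    refine hball ?_
    have h1 : x₀ - δ / 2 ≤ x := (le_max_right _ _).trans (hα ▸ hx.1)
    have h2 : x ≤ x₀ + δ / 2 := (hβ ▸ hx.2 : x ≤ min L (x₀ + δ / 2)).trans (min_le_right _ _)
    rw [Real.dist_eq, abs_lt]
    constructor <;> linarith
  obtain ⟨m, hm⟩ : ∃ m, m = (α + β) / 2 := ⟨_, rfl⟩
  refine ⟨(2 : ℝ) • e m - e α - e β, ?_⟩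
  have hv : ∀ x, 0 ≤ x → inner ℝ (e x) ((2 : ℝ) • e m - e α - e β) =
      2 * min x m - min x α - min x β := fun x hx => by
    rw [inner_sub_right, inner_sub_right, inner_smul_right, he x m hx (by linarith),
      he x α hx hα0, he x β hx (by linarith)]
  have hnonneg : ∀ x ∈ Ioc 0 L,
      0 ≤ a x * max (inner ℝ (e x) ((2 : ℝ) • e m - e α - e β)) 0 ^ p := fun x hx => by
    rw [hv x hx.1.le]
    by_cases h : x ∈ Icc α β
    · exact mul_nonneg (hapos x h).le (by positivity)
    · have : 2 * min x m - min x α - min x β = 0 := by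
        rcases not_and_or.1 h with h | h
        · rw [min_eq_left (by linarith), min_eq_left (by linarith), min_eq_left (by linarith)]
          ring
        · rw [min_eq_right (by linarith), min_eq_right (by linarith), min_eq_right (by linarith)]
          linarith
      rw [this, max_self, zero_rpow (by linarith), mul_zero]
  have hcont : Continuous fun x => inner ℝ (e x) ((2 : ℝ) • e m - e α - e β) := by fun_prop
  refine intervalIntegral.integral_pos hL
    (ha.mul ((continuous_max_zero_rpow (by linarith)).comp hcont)).continuousOn hnonneg
    ⟨m, ⟨by linarith, by linarith⟩, ?_⟩
  · have h1 : 2 * min m m - min m α - min m β = m - α := by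
      rw [min_self, min_eq_right (by linarith), min_eq_left (by linarith)]; ring
    rw [hv m (by linarith), h1, max_eq_left (by linarith)]
    exact mul_pos (hapos m ⟨by linarith, by linarith⟩) (rpow_pos_of_pos (by linarith) _)

theorem exists_lt_integral_mul_max_inner_rpow {κ : ℝ} (hL : 0 < L) (hp : 1 < p) (hp2 : p < 2)
    (ha : Continuous a) (hpos : ∃ x ∈ Icc 0 L, 0 < a x) (hec : Continuous e)
    (he : ∀ x y, 0 ≤ x → 0 ≤ y → inner ℝ (e x) (e y) = min x y) :
    ∃ v : H, κ * ‖v‖ ^ 2 < ∫ x in (0 : ℝ)..L, a x * max (inner ℝ (e x) v) 0 ^ p := by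
  obtain ⟨v, hv⟩ := exists_integral_mul_max_inner_rpow_pos hL hp ha hpos hec he
  have hlim : Tendsto (fun t : ℝ => t ^ (2 - p) * (κ * ‖v‖ ^ 2)) (𝓝[>] 0) (𝓝 0) := by
    have : ContinuousAt (fun t : ℝ => t ^ (2 - p) * (κ * ‖v‖ ^ 2)) 0 :=
      (continuousAt_id.rpow_const (Or.inr (by linarith))).mul continuousAt_const
    have h := this.tendsto
    rw [zero_rpow (by linarith), zero_mul] at h
    exact h.mono_left nhdsWithin_le_nhds
  obtain ⟨t, ht, ht0⟩ := ((hlim.eventually_lt_const hv).and self_mem_nhdsWithin).exists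
  have ht0 : 0 < t := ht0
  refine ⟨t • v, ?_⟩
  have h1 : ∫ x in (0 : ℝ)..L, a x * max (inner ℝ (e x) (t • v)) 0 ^ p =
      t ^ p * ∫ x in (0 : ℝ)..L, a x * max (inner ℝ (e x) v) 0 ^ p := by
    rw [← intervalIntegral.integral_const_mul]
    refine integral_congr fun x _ => ?_
    have : max (t * inner ℝ (e x) v) 0 = t * max (inner ℝ (e x) v) 0 := by
      rw [mul_max_of_nonneg _ _ ht0.le, mul_zero]
    simp only [inner_smul_right, this, mul_rpow ht0.le (le_max_right _ (0 : ℝ))]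
    ring
  have h2 : κ * ‖t • v‖ ^ 2 = t ^ p * (t ^ (2 - p) * (κ * ‖v‖ ^ 2)) := by
    rw [← mul_assoc (t ^ p), ← rpow_add ht0, add_sub_cancel, rpow_two, norm_smul,
      norm_of_nonneg ht0.le]
    ring
  rw [h1, h2]
  gcongr

theorem exists_minimizer_integral_mul_max_inner_rpow {κ : ℝ} [CompleteSpace H]
    [TopologicalSpace.SeparableSpace H] (hκ : 0 < κ) (hL : 0 < L) (hp : 1 < p) (hp2 : p < 2)
    (ha : Continuous a) (hneg : (∫ x in (0 : ℝ)..L, a x) < 0)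
    (hpos : ∃ x ∈ Icc 0 L, 0 < a x) (hec : Continuous e)
    (he : ∀ x y, 0 ≤ x → 0 ≤ y → inner ℝ (e x) (e y) = min x y) :
    ∃ (c : ℝ) (v : H), κ * ‖v‖ ^ 2 < (∫ x in (0 : ℝ)..L, a x * max (c + inner ℝ (e x) v) 0 ^ p) ∧
      ∀ (c' : ℝ) (v' : H),
        κ * ‖v‖ ^ 2 - (∫ x in (0 : ℝ)..L, a x * max (c + inner ℝ (e x) v) 0 ^ p) ≤
        κ * ‖v'‖ ^ 2 - ∫ x in (0 : ℝ)..L, a x * max (c' + inner ℝ (e x) v') 0 ^ p := by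
  set K := max 1 (p * 2 ^ (p - 1) * (∫ x in (0 : ℝ)..L, |a x|) / -∫ x in (0 : ℝ)..L, a x) with hK
  have hK1 : 1 ≤ K := le_max_left _ _
  have hM0 : 0 ≤ ∫ x in (0 : ℝ)..L, |a x| := integral_nonneg hL.le fun x _ => abs_nonneg _
  have hcont : ∀ v : H, Continuous fun x => inner ℝ (e x) v := fun v => by fun_prop
  have hr : ∀ v : H, ∀ x ∈ Icc 0 L, |inner ℝ (e x) v| ≤ √L * ‖v‖ :=
    fun v x hx => abs_inner_le_of_inner_eq_min he v hx
  have hcK : ∀ (c : ℝ) (v : H), 0 < (∫ x in (0 : ℝ)..L, a x * max (c + inner ℝ (e x) v) 0 ^ p) →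
      |c| ≤ K * (√L * ‖v‖) := fun c v h =>
    abs_le_of_integral_mul_max_rpow_pos hL hp ha hneg (hcont v) (hr v) h
  refine exists_minimizer_of_weakly_continuous (K := K * √L)
    (C := (∫ x in (0 : ℝ)..L, |a x|) * ((K + 1) * √L) ^ p) (p := p)
    hκ (by positivity) (by linarith) hp2 ?_ ?_ ?_ ?_
  · rintro c v c₀ v₀ hc hv ⟨R, hR⟩
    refine tendsto_integral_mul_max_rpow (B := c₀ + 1 + √L * R) hL hp ha
      (fun n => continuous_const.add (hcont _)) ?_ fun x _ => hc.add (hv (e x))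
    filter_upwards [hc.eventually_lt_const (lt_add_one c₀)] with n hn x hx
    have h1 := (abs_le.1 (hr (v n) x hx)).2
    have h2 : √L * ‖v n‖ ≤ √L * R := by gcongr; exact hR n
    linarith
  · intro c v h
    rw [mul_assoc]
    exact hcK c v h
  · intro c v
    rcases le_or_gt (∫ x in (0 : ℝ)..L, a x * max (c + inner ℝ (e x) v) 0 ^ p) 0 with h | h
    · exact h.trans (by positivity)
    · refine (integral_mul_max_rpow_le hL hp ha (hcont v) (hr v) (hcK c v h)).trans_eq ?_
      rw [← mul_assoc, mul_rpow (by positivity) (norm_nonneg v), mul_assoc]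
  · obtain ⟨v, hv⟩ := exists_lt_integral_mul_max_inner_rpow (κ := κ) hL hp hp2 ha hpos hec he
    exact ⟨0, v, by simpa only [zero_add] using hv⟩

/-- The weak Euler-Lagrange equation of a minimizer. -/
theorem inner_eq_integral_of_minimizer {c : ℝ} {v : H} (hp : 1 < p) (ha : Continuous a)
    (hec : Continuous e)
    (hmin : ∀ (c' : ℝ) (v' : H),
      p / 2 * ‖v‖ ^ 2 - (∫ x in (0 : ℝ)..L, a x * max (c + inner ℝ (e x) v) 0 ^ p) ≤
      p / 2 * ‖v'‖ ^ 2 - ∫ x in (0 : ℝ)..L, a x * max (c' + inner ℝ (e x) v') 0 ^ p)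
    (s : ℝ) (w : H) :
    inner ℝ v w =
      ∫ x in (0 : ℝ)..L, a x * max (c + inner ℝ (e x) v) 0 ^ (p - 1) * (s + inner ℝ (e x) w) := by
  have hΦ := hasDerivAt_integral_mul_max_rpow (L := L) (u := fun x => c + inner ℝ (e x) v)
    (φ := fun x => s + inner ℝ (e x) w) hp ha (by fun_prop) (by fun_prop)
  have hN : HasDerivAt (fun t : ℝ => p / 2 * ‖v + t • w‖ ^ 2) (p * inner ℝ v w) 0 := by
    have h := ((((hasDerivAt_id (0 : ℝ)).smul_const w).const_add v).norm_sq).const_mul (p / 2)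
    refine h.congr_deriv ?_
    simp only [id, zero_smul, add_zero, one_smul]
    ring
  have hd := hN.sub hΦ
  have hloc : IsLocalMin ((fun t : ℝ => p / 2 * ‖v + t • w‖ ^ 2) - fun t =>
      ∫ x in (0 : ℝ)..L, a x * max (c + inner ℝ (e x) v + t * (s + inner ℝ (e x) w)) 0 ^ p) 0 := by
    refine Eventually.of_forall fun t => ?_
    have h := hmin (c + t * s) (v + t • w)
    have h' : ∀ x, c + t * s + inner ℝ (e x) (v + t • w) =
        c + inner ℝ (e x) v + t * (s + inner ℝ (e x) w) := fun x => by
      rw [inner_add_right, inner_smul_right]; ring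
    simp only [h'] at h
    simpa using h
  have h0 := hloc.hasDerivAt_eq_zero hd
  have hp0 : p ≠ 0 := by linarith
  rw [← mul_sub] at h0
  exact sub_eq_zero.1 ((mul_eq_zero.1 h0).resolve_left hp0)

end GreenKernel

theorem exists_nontrivial_neumannSolution_of_continuous {L q : ℝ} {a : ℝ → ℝ} (hL : 0 < L)
    (hq : q ∈ Ioo (0 : ℝ) 1) (ha : Continuous a) (hpos : ∃ x ∈ Icc 0 L, 0 < a x)
    (hneg : (∫ x in (0 : ℝ)..L, a x) < 0) :
    ∃ u u' u'' : ℝ → ℝ, NeumannSolution L q a u u' u'' ∧ ∃ x ∈ Icc (0 : ℝ) L, u x ≠ 0 := by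
  obtain ⟨hq0, hq1⟩ := hq
  obtain ⟨e, hec, he⟩ := exists_continuous_inner_eq_min
  have : Fact ((2 : ENNReal) ≠ ⊤) := ⟨by simp⟩
  obtain ⟨c, v, hlt, hmin⟩ := exists_minimizer_integral_mul_max_inner_rpow (p := q + 1)
    (κ := (q + 1) / 2) (by linarith) hL (by linarith) (by linarith) ha hneg hpos hec he
  have hEL := inner_eq_integral_of_minimizer (by linarith) ha hec hmin
  rw [add_sub_cancel_right] at hEL
  set g : ℝ → ℝ := fun x => a x * max (c + inner ℝ (e x) v) 0 ^ q with hg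
  have hgc : Continuous g :=
    ha.mul ((continuous_max_zero_rpow hq0.le).comp (by fun_prop))
  have hg0 : ∫ x in (0 : ℝ)..L, g x = 0 := by
    have := hEL 1 0
    simp only [inner_zero_right, add_zero, mul_one] at this
    exact this.symm
  set U : ℝ → ℝ := fun y => c + ((∫ x in (0 : ℝ)..y, g x * x) + y * ∫ x in y..L, g x) with hU
  have hUeq : ∀ y ∈ Icc 0 L, U y = c + inner ℝ (e y) v := fun y hy => by
    simp only [hU]
    rw [← integral_mul_min hgc hy, real_inner_comm, hEL 0 (e y)]
    congr 1
    refine integral_congr fun x hx => ?_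
    rw [uIcc_of_le hL.le] at hx
    simp only [he x y hx.1 hy.1, zero_add, hg]
  have hUd : ∀ y, HasDerivAt U (∫ x in y..L, g x) y := fun y =>
    (hasDerivAt_integral_mul_id_add_mul_integral hgc y).const_add c
  have hUd' : ∀ y, HasDerivAt (fun y => ∫ x in y..L, g x) (-g y) y := fun y =>
    hasDerivAt_integral_lower_limit hgc y
  have hsol : ∀ y ∈ Icc 0 L, g y = a y * max (U y) 0 ^ q := fun y hy => by rw [hUeq y hy]
  have hposΦ : 0 < ∫ x in (0 : ℝ)..L, a x * max (c + inner ℝ (e x) v) 0 ^ (q + 1) :=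
    lt_of_le_of_lt (by positivity) hlt
  have hex : ∃ x ∈ Icc 0 L, 0 < U x := by
    by_contra! h
    refine hposΦ.ne' (integral_zero_ae (Eventually.of_forall fun x hx => ?_))
    rw [uIoc_of_le hL.le] at hx
    have hx' := Ioc_subset_Icc_self hx
    rw [← hUeq x hx', max_eq_right (h x hx'), zero_rpow (by linarith), mul_zero]
  have hnonneg : ∀ y ∈ Icc 0 L, 0 ≤ U y := by
    refine (nonneg_or_neg_of_second_deriv_eq_zero hL (fun y _ => hUd y) (fun y _ => hUd' y)
      hg0 integral_same fun y hy h => ?_).resolve_right fun h => ?_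
    · rw [hsol y hy, max_eq_right h.le, zero_rpow hq0.ne', mul_zero, neg_zero]
    · obtain ⟨x, hx, hx0⟩ := hex
      exact (h x hx).not_gt hx0
  refine ⟨U, fun y => ∫ x in y..L, g x, fun y => -g y, ⟨fun x _ => (hUd x).hasDerivWithinAt,
    fun x _ => (hUd' x).hasDerivWithinAt, hgc.neg.continuousOn, hnonneg, hg0, integral_same,
    fun x hx => ?_⟩, ?_⟩
  · rw [neg_neg, hsol x hx, max_eq_left (hnonneg x hx)]
  · obtain ⟨x, hx, hx0⟩ := hex
    exact ⟨x, hx, hx0.ne'⟩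

/-- Existence of a nontrivial solution for the one-dimensional Neumann problem under
condition (A.0): if the sign-changing continuous weight `a` satisfies `∫₀^L a < 0`,
then `(P_N)` has a nontrivial solution. -/
theorem stmt_6 (L q : ℝ) (hL : 0 < L) (hq : q ∈ Set.Ioo (0 : ℝ) 1)
    (a : ℝ → ℝ) (ha : ContinuousOn a (Set.Icc 0 L)) (hsign : ChangesSign L a)
    (hA0 : (∫ x in (0 : ℝ)..L, a x) < 0) :
    ∃ u u' u'' : ℝ → ℝ,
      NeumannSolution L q a u u' u'' ∧ ∃ x ∈ Set.Icc (0 : ℝ) L, u x ≠ 0 := by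
  obtain ⟨x₀, hx₀, hpos⟩ := hsign.1
  have hb : ∀ x ∈ Icc 0 L, IccExtend hL.le ((Icc 0 L).domRestrict a) x = a x :=
    fun x hx => IccExtend_of_mem hL.le _ hx
  obtain ⟨u, u', u'', ⟨h1, h2, h3, h4, h5, h6, h7⟩, hne⟩ :=
    exists_nontrivial_neumannSolution_of_continuous hL hq
      (a := IccExtend hL.le ((Icc 0 L).domRestrict a))
      (continuousOn_iff_continuous_domRestrict.1 ha).Icc_extend'
      ⟨x₀, hx₀, by rwa [hb x₀ hx₀]⟩
      ((integral_congr fun x hx => hb x (by rwa [uIcc_of_le hL.le] at hx)).trans_lt hA0)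
  exact ⟨u, u', u'', ⟨h1, h2, h3, h4, h5, h6, fun x hx => by rw [h7 x hx, hb x hx]⟩, hne⟩
end

section
/- (Necessity of condition (A.0) for positive Neumann solutions.) Let L > 0, q ∈ (0,1), and let a : [0,L] → ℝ be continuous and change sign. If the Neumann problem (P_N) has a positive solution, i.e. a twice continuously differentiable u : [0,L] → ℝ with u > 0 on (0,L), u'(0) = u'(L) = 0, and −u''(x) = a(x)·u(x)^q for all x ∈ [0,L], then ∫₀^L a(x) dx < 0. -/
open Real Set

/-- On an interval containing a critical point of `u`, a maximum point `s` of `u` satisfies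
`|u' s| ≤ M * length * u s ^ q`, provided `|u''| ≤ M * u ^ q`. -/
lemma exists_abs_deriv_le_mul_rpow {c d e q M : ℝ} {u u' u'' : ℝ → ℝ} (hq : 0 ≤ q) (hM : 0 ≤ M)
    (hcont : ContinuousOn u (Set.Icc c d))
    (hd' : ∀ x ∈ Set.Icc c d, HasDerivWithinAt u' (u'' x) (Set.Icc c d) x)
    (hnonneg : ∀ x ∈ Set.Icc c d, 0 ≤ u x) (hpos : ∃ x ∈ Set.Icc c d, 0 < u x)
    (he : e ∈ Set.Icc c d) (hue : u' e = 0)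
    (hbound : ∀ x ∈ Set.Icc c d, |u'' x| ≤ M * u x ^ q) :
    ∃ s ∈ Set.Icc c d, 0 < u s ∧ |u' s| ≤ M * (d - c) * u s ^ q := by
  obtain ⟨p, hp, hup⟩ := hpos
  obtain ⟨s, hs, hmax⟩ := isCompact_Icc.exists_isMaxOn ⟨p, hp⟩ hcont
  refine ⟨s, hs, hup.trans_le (hmax hp), ?_⟩
  have hbound' : ∀ x ∈ Set.Icc c d, ‖u'' x‖ ≤ M * u s ^ q := fun x hx =>
    (hbound x hx).trans (mul_le_mul_of_nonneg_left
      (Real.rpow_le_rpow (hnonneg x hx) (hmax hx) hq) hM)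
  have key := (convex_Icc c d).norm_image_sub_le_of_norm_hasDerivWithin_le hd' hbound' he hs
  rw [hue, sub_zero, Real.norm_eq_abs, Real.norm_eq_abs] at key
  have hdist : |s - e| ≤ d - c := by
    rw [abs_le]; constructor <;> linarith [hs.1, hs.2, he.1, he.2]
  have hK : 0 ≤ M * u s ^ q := mul_nonneg hM (Real.rpow_nonneg (hnonneg s hs) q)
  calc |u' s| ≤ M * u s ^ q * |s - e| := key
    _ ≤ M * u s ^ q * (d - c) := mul_le_mul_of_nonneg_left hdist hK
    _ = M * (d - c) * u s ^ q := by ring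

/-- If `-u'' = b * u ^ q` and `A' = b` at a point where `u > 0`, then `-u' * u ^ (-q) - A` has
derivative `q * u' ^ 2 * u ^ (-q - 1)`. -/
lemma hasDerivWithinAt_neg_deriv_mul_rpow_sub {q x b u₂ : ℝ} {S : Set ℝ} {u u' A : ℝ → ℝ}
    (hd : HasDerivWithinAt u (u' x) S x) (hd' : HasDerivWithinAt u' u₂ S x)
    (hA : HasDerivWithinAt A b S x) (hu : 0 < u x) (heq : -u₂ = b * u x ^ q) :
    HasDerivWithinAt (fun y => -u' y * u y ^ (-q) - A y)
      (q * u' x ^ 2 * u x ^ (-q - 1)) S x := by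
  have h := (hd'.fun_neg.fun_mul (hd.rpow_const (p := -q) (Or.inl hu.ne'))).fun_sub hA
  refine h.congr_deriv ?_
  have h1 : u x ^ q * u x ^ (-q) = 1 := by
    rw [← Real.rpow_add hu, add_neg_cancel, Real.rpow_zero]
  rw [heq]
  linear_combination b * h1

/-- A function with positive derivative at an interior point exceeds its value there at some point
to the right. -/
lemma exists_gt_of_hasDerivAt_pos {f : ℝ → ℝ} {c x d : ℝ} (hf : HasDerivAt f c x) (hc : 0 < c)
    (hd : x < d) : ∃ y ∈ Set.Ioo x d, f x < f y := by
  have h1 := (hasDerivWithinAt_iff_tendsto_slope' (Set.self_notMem_Ioi)).1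
    (hf.hasDerivWithinAt (s := Set.Ioi x))
  obtain ⟨y, hy, hmem⟩ := ((h1.eventually (lt_mem_nhds hc)).and
    (Ioo_mem_nhdsGT hd)).exists
  refine ⟨y, hmem, ?_⟩
  rw [slope_def_field] at hy
  have := (div_pos_iff_of_pos_right (sub_pos.2 hmem.1)).1 hy
  linarith

/-- If `-u'' = a * u ^ q` with `u > 0` on `(0, L)` and `a` is somewhere positive, then `u` is not
constant on `(0, L)`. -/
lemma exists_deriv_ne_zero {L q : ℝ} (hL : 0 < L) {a u u' u'' : ℝ → ℝ}
    (ha : ContinuousOn a (Set.Icc 0 L)) (hsign : ∃ x ∈ Set.Icc (0 : ℝ) L, 0 < a x)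
    (hd' : ∀ x ∈ Set.Icc (0 : ℝ) L, HasDerivWithinAt u' (u'' x) (Set.Icc 0 L) x)
    (hpos : ∀ x ∈ Set.Ioo (0 : ℝ) L, 0 < u x)
    (heq : ∀ x ∈ Set.Icc (0 : ℝ) L, -u'' x = a x * u x ^ q) :
    ∃ x ∈ Set.Ioo (0 : ℝ) L, u' x ≠ 0 := by
  by_contra! h
  have hzero : Set.EqOn a (fun _ => 0) (Set.Ioo 0 L) := by
    intro x hx
    have h1 := (hd' x (Set.Ioo_subset_Icc_self hx)).hasDerivAt (Icc_mem_nhds hx.1 hx.2)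
    have h2 : HasDerivAt u' 0 x := (hasDerivAt_const x (0 : ℝ)).congr_of_eventuallyEq
      (Filter.eventually_of_mem (Ioo_mem_nhds hx.1 hx.2) h)
    have h3 := heq x (Set.Ioo_subset_Icc_self hx)
    rw [h1.unique h2, neg_zero] at h3
    exact (mul_eq_zero.1 h3.symm).resolve_right (Real.rpow_pos_of_pos (hpos x hx) q).ne'
  obtain ⟨x, hx, hax⟩ := hsign
  have := hzero.of_subset_closure ha continuousOn_const Set.Ioo_subset_Icc_self
    (closure_Ioo hL.ne).ge hx
  exact hax.ne' this

/-- Necessity of condition (A.0) for positive Neumann solutions: if the one-dimensional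
Neumann problem with sign-changing continuous weight `a` has a positive solution, then
`∫₀^L a < 0`. -/
theorem stmt_7 (L q : ℝ) (hL : 0 < L) (hq : q ∈ Set.Ioo (0 : ℝ) 1)
    (a : ℝ → ℝ) (ha : ContinuousOn a (Set.Icc 0 L)) (hsign : ChangesSign L a)
    (u u' u'' : ℝ → ℝ)
    (hd : ∀ x ∈ Set.Icc (0 : ℝ) L, HasDerivWithinAt u (u' x) (Set.Icc 0 L) x)
    (hd' : ∀ x ∈ Set.Icc (0 : ℝ) L, HasDerivWithinAt u' (u'' x) (Set.Icc 0 L) x)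
    (hc : ContinuousOn u'' (Set.Icc 0 L))
    (hpos : ∀ x ∈ Set.Ioo (0 : ℝ) L, 0 < u x)
    (hbc0 : u' 0 = 0) (hbcL : u' L = 0)
    (heq : ∀ x ∈ Set.Icc (0 : ℝ) L, -u'' x = a x * u x ^ q) :
    (∫ x in (0 : ℝ)..L, a x) < 0 := by
  have hb : ∃ b : ℝ → ℝ, Continuous b ∧ Set.EqOn b a (Set.Icc 0 L) :=
    ⟨Set.IccExtend hL.le ((Set.Icc 0 L).domRestrict a), ha.domRestrict.Icc_extend',
      fun x hx => Set.IccExtend_of_mem hL.le _ hx⟩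
  obtain ⟨b, hbc, hba⟩ := hb
  obtain ⟨M, hM⟩ := isCompact_Icc.exists_bound_of_continuousOn (s := Set.Icc 0 L) hbc.continuousOn
  have hM0 : 0 ≤ M := (norm_nonneg _).trans (hM 0 (Set.left_mem_Icc.2 hL.le))
  have hint : ∫ x in (0 : ℝ)..L, a x = ∫ x in (0 : ℝ)..L, b x :=
    intervalIntegral.integral_congr fun x hx => (hba (by rwa [Set.uIcc_of_le hL.le] at hx)).symm
  rw [hint]
  set A : ℝ → ℝ := fun x => ∫ y in (0 : ℝ)..x, b y with hAdef
  have hA : ∀ x, HasDerivAt A (b x) x := fun x => hbc.integral_hasStrictDerivAt 0 x |>.hasDerivAt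
  have hA0 : A 0 = 0 := intervalIntegral.integral_same
  have hAlip : ∀ x ∈ Set.Icc 0 L, ∀ y ∈ Set.Icc 0 L, |A y - A x| ≤ M * |y - x| :=
    fun x hx y hy => (convex_Icc 0 L).norm_image_sub_le_of_norm_hasDerivWithin_le
      (fun z _ => (hA z).hasDerivWithinAt) hM hx hy
  have hucont : ContinuousOn u (Set.Icc 0 L) := fun x hx => (hd x hx).continuousWithinAt
  have hnonneg : ∀ x ∈ Set.Icc 0 L, 0 ≤ u x := by
    intro x hx
    rw [← closure_Ioo hL.ne] at hx hucont
    exact le_on_closure (fun y hy => (hpos y hy).le) continuousOn_const hucont hx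
  have hbound : ∀ x ∈ Set.Icc 0 L, |u'' x| ≤ M * u x ^ q := by
    intro x hx
    rw [← abs_neg, heq x hx, ← hba hx, abs_mul, abs_of_nonneg (Real.rpow_nonneg (hnonneg x hx) q)]
    exact mul_le_mul_of_nonneg_right (hM x hx) (Real.rpow_nonneg (hnonneg x hx) q)
  have hpick : ∀ c d e : ℝ, 0 ≤ c → c < d → d ≤ L → e ∈ Set.Icc c d → u' e = 0 →
      ∃ s ∈ Set.Icc c d, 0 < u s ∧ |u' s * u s ^ (-q)| ≤ M * (d - c) := by
    intro c d e hc0 hcd hdL he hue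
    have hsub : Set.Icc c d ⊆ Set.Icc 0 L := Set.Icc_subset_Icc hc0 hdL
    obtain ⟨s, hs, hus, hle⟩ := exists_abs_deriv_le_mul_rpow hq.1.le hM0 (hucont.mono hsub)
      (fun x hx => (hd' x (hsub hx)).mono hsub) (fun x hx => hnonneg x (hsub hx))
      ⟨(c + d) / 2, ⟨by linarith, by linarith⟩, hpos _ ⟨by linarith, by linarith⟩⟩ he hue
      (fun x hx => hbound x (hsub hx))
    refine ⟨s, hs, hus, ?_⟩
    have hp := Real.rpow_pos_of_pos hus q
    rw [Real.rpow_neg hus.le, abs_mul, abs_inv, abs_of_pos hp, ← div_eq_mul_inv, div_le_iff₀ hp]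
    exact hle
  set H : ℝ → ℝ := fun y => -u' y * u y ^ (-q) - A y with hH
  have hHd : ∀ x ∈ Set.Icc 0 L, 0 < u x →
      HasDerivWithinAt H (q * u' x ^ 2 * u x ^ (-q - 1)) (Set.Icc 0 L) x := fun x hx hux =>
    hasDerivWithinAt_neg_deriv_mul_rpow_sub (hd x hx) (hd' x hx) (hA x).hasDerivWithinAt hux
      (by rw [heq x hx, hba hx])
  have hHmono : ∀ s t, 0 ≤ s → t ≤ L → 0 < u s → 0 < u t → MonotoneOn H (Set.Icc s t) := by
    intro s t hs ht hus hut
    have hsub : Set.Icc s t ⊆ Set.Icc 0 L := Set.Icc_subset_Icc hs ht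
    have hu : ∀ x ∈ Set.Icc s t, 0 < u x := by
      intro x hx
      rcases hx.1.eq_or_lt with rfl | h1
      · exact hus
      rcases hx.2.eq_or_lt with rfl | h2
      · exact hut
      exact hpos x ⟨hs.trans_lt h1, h2.trans_le ht⟩
    have hder := fun x (hx : x ∈ Set.Icc s t) => (hHd x (hsub hx) (hu x hx)).mono hsub
    refine monotoneOn_of_hasDerivWithinAt_nonneg (convex_Icc s t)
      (fun x hx => (hder x hx).continuousWithinAt)
      (fun x hx => (hder x (interior_subset hx)).mono interior_subset) fun x hx => ?_
    have := hq.1.le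
    have := Real.rpow_nonneg (hu x (interior_subset hx)).le (-q - 1)
    positivity
  obtain ⟨α, hα, huα⟩ := exists_deriv_ne_zero hL ha hsign.1 hd' hpos heq
  obtain ⟨β, hβ, hαβ⟩ := exists_gt_of_hasDerivAt_pos
    ((hHd α (Set.Ioo_subset_Icc_self hα) (hpos α hα)).hasDerivAt (Icc_mem_nhds hα.1 hα.2))
    (mul_pos (mul_pos hq.1 (by positivity)) (Real.rpow_pos_of_pos (hpos α hα) _)) hα.2
  have hsmall : ∀ δ, 0 < δ → δ ≤ α → δ ≤ L - β → A L ≤ 4 * M * δ - (H β - H α) := by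
    intro δ hδ hδα hδβ
    have hαL := hα.2
    have hβα := hβ.1
    obtain ⟨s, hs, hus, hGs⟩ := hpick 0 δ 0 le_rfl hδ (by linarith) ⟨le_rfl, hδ.le⟩ hbc0
    obtain ⟨t, ht, hut, hGt⟩ := hpick (L - δ) L L (by linarith) (by linarith) le_rfl
      ⟨by linarith, le_rfl⟩ hbcL
    have hmono := hHmono s t hs.1 ht.2 hus hut
    have h1 : H s ≤ H α := hmono ⟨le_rfl, by linarith [hs.2, ht.1]⟩
      ⟨by linarith [hs.2], by linarith [ht.1]⟩ (by linarith [hs.2])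
    have h2 : H β ≤ H t := hmono ⟨by linarith [hs.2], by linarith [ht.1]⟩
      ⟨by linarith [hs.2, ht.1], le_rfl⟩ (by linarith [ht.1])
    have h3 := hAlip 0 ⟨le_rfl, hL.le⟩ s ⟨hs.1, by linarith [hs.2]⟩
    have h4 := hAlip t ⟨by linarith [ht.1], ht.2⟩ L ⟨hL.le, le_rfl⟩
    rw [sub_zero, abs_of_nonneg hs.1, hA0, sub_zero] at h3
    rw [abs_of_nonneg (sub_nonneg.2 ht.2)] at h4
    have h5 : M * s ≤ M * δ := mul_le_mul_of_nonneg_left hs.2 hM0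
    have h6 : M * (L - t) ≤ M * δ := mul_le_mul_of_nonneg_left (by linarith [ht.1]) hM0
    have h7 : H s = -(u' s * u s ^ (-q)) - A s := by simp only [hH]; ring
    have h8 : H t = -(u' t * u t ^ (-q)) - A t := by simp only [hH]; ring
    rw [sub_zero] at hGs
    rw [sub_sub_cancel] at hGt
    linarith [(abs_le.1 hGs).2, (abs_le.1 hGt).1, le_of_abs_le h3, le_of_abs_le h4]
  have hκ : 0 < H β - H α := sub_pos.2 hαβ
  have hM1 : 0 < 4 * M + 1 := by linarith
  set δ := min (min α (L - β)) ((H β - H α) / (4 * M + 1)) with hδdef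
  have hδ : 0 < δ := lt_min (lt_min hα.1 (sub_pos.2 hβ.2)) (div_pos hκ hM1)
  have h1 := hsmall δ hδ ((min_le_left _ _).trans (min_le_left _ _))
    ((min_le_left _ _).trans (min_le_right _ _))
  have h2 : δ * (4 * M + 1) ≤ H β - H α := (le_div_iff₀ hM1).1 (min_le_right _ _)
  change A L < 0
  linarith
end
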